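/- arXiv:2409.06418 — 3 statements merged into one kernel-verified Lean document; each statement's English description precedes it below -/
import Mathlib

section
/- Let G be a strongly regular conference graph with parameters (4γ+1, 2γ, γ−1, γ), γ ≥ 2, and let x, y be adjacent vertices. Then there exists a perfect matching between N_x = Γ(x) \ (Γ(x)∩Γ(y) ∪ {y}) and N_y = Γ(y) \ (Γ(x)∩Γ(y) ∪ {x}), i.e., a bijection φ: N_x → N_y such that v is adjacent to φ(v) for every v ∈ N_x. -/
section ConfAux

open Finset

/-- The purely numerical part of the argument. -/
theorem conf_numeric (s t γ e p QC QR QM QS QO : ℤ)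
    (hs : 2 ≤ s) (hst : s ≤ t) (hsum : s + t = γ + 1)
    (he : 0 ≤ e) (hp : 0 ≤ p) (hpe : p ≤ e) (hem : e ≤ s * (s - 1))
    (key : 4 * s * e = s * (s - 1) * γ + QC + QR + QM + QS + QO + p)
    (hC : e ^ 2 ≤ (γ - 1) * QC) (hC1 : e ≤ QC) (hC3 : 3 * e - 2 * (γ - 1) ≤ QC)
    (hR : e ^ 2 ≤ γ * QR) (hR1 : e ≤ QR)
    (hM : e ^ 2 ≤ (s - 1) * QM) (hM1 : e ≤ QM)
    (hX : e ^ 2 ≤ γ * (QS + QO)) (hX1 : e ≤ QS + QO)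
    (hS1 : p ≤ QS) (hO : (e - p) ^ 2 ≤ (t - 1) * QO) : False := by
  have hγ : 0 < γ := by linarith
  have hm : 0 < s - 1 := by linarith
  have he0 : 0 < e := by
    rcases he.lt_or_eq with h | h
    · exact h
    · exfalso
      have : 0 < s * (s - 1) * γ := by positivity
      subst h
      linarith
  have h1 : (s - 1) * γ * (4 * s * e - s * (s - 1) * γ) > (γ + 3 * (s - 1)) * e ^ 2 := by
    have e1 : e ^ 2 < γ * QC := by nlinarith
    have hsplit : 4 * s * e - s * (s - 1) * γ ≥ QC + QR + QM + (QS + QO) := by linarith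
    have a1 := mul_le_mul_of_nonneg_left hsplit.le (mul_pos hm hγ).le
    have a2 := mul_lt_mul_of_pos_left e1 hm
    have a3 := mul_le_mul_of_nonneg_left hR hm.le
    have a4 := mul_le_mul_of_nonneg_left hX hm.le
    have a5 := mul_le_mul_of_nonneg_left hM hγ.le
    nlinarith
  have h2 : γ + 3 * (s - 1) < 4 * s := by
    by_contra hcon
    push Not at hcon
    have b1 : (4 * s) * e ^ 2 ≤ (γ + 3 * (s - 1)) * e ^ 2 :=
      mul_le_mul_of_nonneg_right hcon (by positivity)
    have b2 : 0 ≤ s * (2 * e - (s - 1) * γ) ^ 2 := by positivity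
    nlinarith
  have ht : t ≤ 3 := by linarith
  have hs3 : s ≤ 3 := by linarith
  obtain rfl : γ = s + t - 1 := by linarith
  have : s = 2 ∨ s = 3 := by omega
  rcases this with rfl | rfl
  · have : t = 2 ∨ t = 3 := by omega
    rcases this with rfl | rfl <;> norm_num at * <;> (have : e ≤ 2 := by linarith) <;>
      interval_cases e <;> interval_cases p <;> omega
  · obtain rfl : t = 3 := by omega
    norm_num at *
    interval_cases e <;> interval_cases p <;> omega

theorem conf_sum_bounds {V : Type*} (B : Finset V) (f : V → ℤ) :
    (∑ z ∈ B, f z) ^ 2 ≤ (B.card : ℤ) * ∑ z ∈ B, f z ^ 2 ∧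
    ∑ z ∈ B, f z ≤ ∑ z ∈ B, f z ^ 2 ∧
    3 * ∑ z ∈ B, f z - 2 * (B.card : ℤ) ≤ ∑ z ∈ B, f z ^ 2 := by
  refine ⟨sq_sum_le_card_mul_sum_sq, Finset.sum_le_sum fun z _ => ?_, ?_⟩
  · exact Int.le_self_sq (f z)
  · have : (2 : ℤ) * (B.card : ℤ) = ∑ z ∈ B, 2 := by simp [mul_comm]
    rw [this, Finset.mul_sum, ← Finset.sum_sub_distrib]
    refine Finset.sum_le_sum fun z _ => ?_
    rcases le_or_gt (f z) 1 with h | h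
    · nlinarith
    · have : 2 ≤ f z := h
      nlinarith

set_option maxHeartbeats 2000000 in
theorem conf_core {V : Type*} [Fintype V] [DecidableEq V] (G : SimpleGraph V) [DecidableRel G.Adj]
    (γ : ℕ) (hγ : 2 ≤ γ)
    (hsrg : G.IsSRGWith (4 * γ + 1) (2 * γ) (γ - 1) γ)
    (x y : V) (hxy : G.Adj x y) (S T : Finset V)
    (hS : ∀ v ∈ S, G.Adj x v ∧ ¬ G.Adj y v ∧ v ≠ y)
    (hT : ∀ v ∈ T, G.Adj y v ∧ ¬ G.Adj x v ∧ v ≠ x)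
    (hST : ∀ v ∈ S, ∀ w ∈ T, ¬ G.Adj v w)
    (hs1 : 1 ≤ S.card) (hle : S.card ≤ T.card) (hcard : S.card + T.card = γ + 1) : False := by
  set A : V → V → ℤ := fun v z => if G.Adj v z then 1 else 0 with hA
  have Asymm : ∀ v z, A v z = A z v := fun v z => by simp [hA, G.adj_comm]
  have hAA : ∀ v w, ∑ z, A v z * A w z = γ - A v w + (if v = w then (γ : ℤ) else 0) := by
    intro v w
    have e1 : ∑ z, A v z * A w z = ((univ.filter fun z => G.Adj v z ∧ G.Adj w z).card : ℤ) := by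
      rw [Finset.card_filter]
      push_cast
      refine Finset.sum_congr rfl fun z _ => ?_
      simp only [hA]
      split_ifs <;> simp_all
    rw [e1]
    by_cases hvw : v = w
    · subst hvw
      have := hsrg.regular v
      rw [← G.card_neighborFinset_eq_degree, G.neighborFinset_eq_filter] at this
      simp [hA, this]
      ring
    · have e2 : (univ.filter fun z => G.Adj v z ∧ G.Adj w z).card
          = Fintype.card (G.commonNeighbors v w) := by
        rw [← Set.toFinset_card]
        congr 1
        ext z
        simp [SimpleGraph.mem_commonNeighbors]
      by_cases hadj : G.Adj v w
      · rw [e2, hsrg.of_adj v w hadj]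
        simp [hA, hadj, hvw]
        omega
      · rw [e2, hsrg.of_not_adj hvw hadj]
        simp [hA, hadj, hvw]
  have hdeg : ∀ v, ∑ z, A v z = 2 * γ := by
    intro v
    have := hAA v v
    have e : ∀ z, A v z * A v z = A v z := fun z => by simp [hA]
    simp only [e] at this
    rw [this]
    simp [hA]; ring
  have hcardV : (∑ _z : V, (1 : ℤ)) = 4 * γ + 1 := by
    simp [hsrg.card]
  set C := univ.filter fun z => G.Adj x z ∧ G.Adj y z with hCdef
  set X := univ.filter fun z => G.Adj x z ∧ ¬ G.Adj y z ∧ z ≠ y with hXdef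
  set Y := univ.filter fun z => G.Adj y z ∧ ¬ G.Adj x z ∧ z ≠ x with hYdef
  set R := univ.filter fun z => ¬ G.Adj y z ∧ ¬ G.Adj x z ∧ z ≠ x ∧ z ≠ y with hRdef
  have hne : x ≠ y := hxy.ne
  have hyx := hxy.symm
  have split : ∀ f : V → ℤ, ∑ z, f z =
      f x + f y + ∑ z ∈ C, f z + ∑ z ∈ X, f z + ∑ z ∈ Y, f z + ∑ z ∈ R, f z := by
    intro f
    have ex : f x = ∑ z, if z = x then f z else 0 := by simp
    have ey : f y = ∑ z, if z = y then f z else 0 := by simp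
    rw [ex, ey, hCdef, hXdef, hYdef, hRdef]
    simp only [Finset.sum_filter, ← Finset.sum_add_distrib]
    refine Finset.sum_congr rfl fun z _ => ?_
    have := G.loopless
    by_cases h1 : z = x
    · subst h1; simp [hne, hyx]
    · by_cases h2 : z = y
      · subst h2; simp [h1, hxy]
      · by_cases h3 : G.Adj x z <;> by_cases h4 : G.Adj y z <;> simp [h1, h2, h3, h4]
  have Axx : A x x = 0 := by simp [hA]
  have Ayy : A y y = 0 := by simp [hA]
  have Axy : A x y = 1 := by simp [hA, hxy]
  have Ayx : A y x = 1 := by simp [hA, hyx]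
  -- neighbours through x
  have splitx : ∀ f : V → ℤ, ∑ z, f z * A x z = f y + ∑ z ∈ C, f z + ∑ z ∈ X, f z := by
    intro f
    rw [split]
    have c1 : ∑ z ∈ C, f z * A x z = ∑ z ∈ C, f z :=
      Finset.sum_congr rfl fun z hz => by simp [hCdef] at hz; simp [hA, hz]
    have c2 : ∑ z ∈ X, f z * A x z = ∑ z ∈ X, f z :=
      Finset.sum_congr rfl fun z hz => by simp [hXdef] at hz; simp [hA, hz]
    have c3 : ∑ z ∈ Y, f z * A x z = 0 :=
      Finset.sum_eq_zero fun z hz => by simp [hYdef] at hz; simp [hA, hz]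
    have c4 : ∑ z ∈ R, f z * A x z = 0 :=
      Finset.sum_eq_zero fun z hz => by simp [hRdef] at hz; simp [hA, hz]
    rw [c1, c2, c3, c4, Axx, Axy]; ring
  have splity : ∀ f : V → ℤ, ∑ z, f z * A y z = f x + ∑ z ∈ C, f z + ∑ z ∈ Y, f z := by
    intro f
    rw [split]
    have c1 : ∑ z ∈ C, f z * A y z = ∑ z ∈ C, f z :=
      Finset.sum_congr rfl fun z hz => by simp [hCdef] at hz; simp [hA, hz]
    have c2 : ∑ z ∈ Y, f z * A y z = ∑ z ∈ Y, f z :=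
      Finset.sum_congr rfl fun z hz => by simp [hYdef] at hz; simp [hA, hz]
    have c3 : ∑ z ∈ X, f z * A y z = 0 :=
      Finset.sum_eq_zero fun z hz => by simp [hXdef] at hz; simp [hA, hz]
    have c4 : ∑ z ∈ R, f z * A y z = 0 :=
      Finset.sum_eq_zero fun z hz => by simp [hRdef] at hz; simp [hA, hz]
    rw [c1, c2, c3, c4, Ayy, Ayx]; ring
  have dx : ∀ v, v ≠ x → A v y + ∑ z ∈ C, A v z + ∑ z ∈ X, A v z = γ - A v x := by
    intro v hv
    rw [← splitx, hAA]; simp [hv]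
  have dy : ∀ v, v ≠ y → A v x + ∑ z ∈ C, A v z + ∑ z ∈ Y, A v z = γ - A v y := by
    intro v hv
    rw [← splity, hAA]; simp [hv]
  have dall : ∀ v, A v x + A v y + ∑ z ∈ C, A v z + ∑ z ∈ X, A v z + ∑ z ∈ Y, A v z
      + ∑ z ∈ R, A v z = 2 * γ := fun v => by rw [← split, hdeg]
  -- block sizes
  have cardC : (C.card : ℤ) = γ - 1 := by
    have h1 := hAA y x
    rw [splitx (A y)] at h1
    have c1 : ∑ z ∈ C, A y z = C.card := by
      rw [Finset.sum_congr rfl (g := fun _ => (1 : ℤ))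
        (fun z hz => by simp [hCdef] at hz; simp [hA, hz])]
      simp
    have c2 : ∑ z ∈ X, A y z = 0 :=
      Finset.sum_eq_zero fun z hz => by simp [hXdef] at hz; simp [hA, hz]
    rw [c1, c2, Ayy, Ayx] at h1
    simp [hne.symm] at h1
    linarith
  have cardX : (X.card : ℤ) = γ := by
    have h1 := splitx (fun _ => 1)
    simp only [one_mul, hdeg] at h1
    simp at h1
    linarith
  have cardY : (Y.card : ℤ) = γ := by
    have h1 := splity (fun _ => 1)
    simp only [one_mul, hdeg] at h1
    simp at h1
    linarith
  have cardR : (R.card : ℤ) = γ := by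
    have h1 := split (fun _ => 1)
    rw [hcardV] at h1
    simp at h1
    linarith
  have hSX : S ⊆ X := fun v hv => by simp [hXdef]; exact hS v hv
  have hTY : T ⊆ Y := fun v hv => by simp [hYdef]; exact hT v hv
  have AS : ∀ v ∈ S, A v x = 1 ∧ A v y = 0 ∧ v ≠ x ∧ v ≠ y := by
    intro v hv
    obtain ⟨h1, h2, h3⟩ := hS v hv
    refine ⟨by rw [Asymm]; simp [hA, h1], by rw [Asymm]; simp [hA, h2], h1.ne', h3⟩
  have cardM : ((Y \ T).card : ℤ) = S.card - 1 := by
    rw [Finset.card_sdiff_of_subset hTY]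
    have := Finset.card_le_card hTY
    omega
  have cardO : ((X \ S).card : ℤ) = T.card - 1 := by
    rw [Finset.card_sdiff_of_subset hSX]
    have := Finset.card_le_card hSX
    omega
  have hA01 : ∀ v z, 0 ≤ A v z ∧ A v z ≤ 1 := fun v z => by
    simp only [hA]; split_ifs <;> simp
  rcases Nat.eq_or_lt_of_le hs1 with hs | hs
  · -- parity argument
    obtain ⟨v, rfl⟩ := Finset.card_eq_one.mp hs.symm
    obtain ⟨a1, a2, a3, a4⟩ := AS v (by simp)
    have hY0 : ∑ z ∈ Y, A v z = 0 := by
      have hTYe : T = Y := Finset.eq_of_subset_of_card_le hTY (by simp at hcard; omega)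
      refine Finset.sum_eq_zero fun z hz => ?_
      have := hST v (by simp) z (hTYe ▸ hz)
      simp [hA, this]
    have ex := dx v a3
    have ey := dy v a4
    have ea := dall v
    have hC1 : ∑ z ∈ C, (1 - A v z) = 0 := by simp; linarith
    have hR1 : ∑ z ∈ R, (1 - A v z) = 0 := by simp; linarith
    have hX1 : ∑ z ∈ X, A v z = 0 := by linarith
    rw [Finset.sum_eq_zero_iff_of_nonneg (fun z _ => by linarith [(hA01 v z).2])] at hC1 hR1
    have hX1' := (Finset.sum_eq_zero_iff_of_nonneg (fun z _ => (hA01 v z).1)).mp hX1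
    have hY1' := (Finset.sum_eq_zero_iff_of_nonneg (fun z _ => (hA01 v z).1)).mp hY0
    have splitv : ∀ f : V → ℤ, ∑ z, f z * A v z = f x + ∑ z ∈ C, f z + ∑ z ∈ R, f z := by
      intro f
      rw [split]
      have c1 : ∑ z ∈ C, f z * A v z = ∑ z ∈ C, f z :=
        Finset.sum_congr rfl fun z hz => by
          rw [show A v z = 1 by linarith [hC1 z hz]]; ring
      have c2 : ∑ z ∈ R, f z * A v z = ∑ z ∈ R, f z :=
        Finset.sum_congr rfl fun z hz => by
          rw [show A v z = 1 by linarith [hR1 z hz]]; ring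
      have c3 : ∑ z ∈ X, f z * A v z = 0 :=
        Finset.sum_eq_zero fun z hz => by rw [hX1' z hz]; ring
      have c4 : ∑ z ∈ Y, f z * A v z = 0 :=
        Finset.sum_eq_zero fun z hz => by rw [hY1' z hz]; ring
      rw [c1, c2, c3, c4, a1, a2]; ring
    have hCne : C.Nonempty := by
      rw [← Finset.card_pos]; omega
    have hYne : Y.Nonempty := by
      rw [← Finset.card_pos]; omega
    obtain ⟨w, hw⟩ := hCne
    obtain ⟨u, hu⟩ := hYne
    have hw' := hw
    have hu' := hu
    simp only [hCdef, Finset.mem_filter, Finset.mem_univ, true_and] at hw'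
    simp only [hYdef, Finset.mem_filter, Finset.mem_univ, true_and] at hu'
    have wx : A w x = 1 := by rw [Asymm]; simp [hA, hw'.1]
    have wy : A w y = 1 := by rw [Asymm]; simp [hA, hw'.2]
    have ux : A u x = 0 := by rw [Asymm]; simp [hA, hu'.2.1]
    have uy : A u y = 1 := by rw [Asymm]; simp [hA, hu'.1]
    have wv : A w v = 1 := by rw [Asymm]; linarith [hC1 w hw]
    have uv : A u v = 0 := by rw [Asymm]; exact hY1' u hu
    have hwv : w ≠ v := by rintro rfl; simp [hA] at wv
    have huv : u ≠ v := by rintro rfl; rw [a1] at ux; norm_num at ux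
    have w1 := dx w hw'.1.ne'
    have w2 := dy w hw'.2.ne'
    have w3 := dall w
    have w4 := hAA w v
    rw [splitv (A w)] at w4
    have u1 := dx u hu'.2.2
    have u2 := dy u hu'.1.ne'
    have u3 := dall u
    have u4 := hAA u v
    rw [splitv (A u)] at u4
    simp only [hwv, huv, if_false] at w4 u4
    omega
  · set D : V → ℤ := fun z => ∑ v ∈ S, A v z with hD
    have Dsum : ∀ B : Finset V, ∑ z ∈ B, D z = ∑ v ∈ S, ∑ z ∈ B, A v z := fun B =>
      Finset.sum_comm
    have Dx : D x = S.card := by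
      simp only [hD]
      rw [Finset.sum_congr rfl (g := fun _ => (1 : ℤ)) (fun v hv => (AS v hv).1)]; simp
    have Dy : D y = 0 := Finset.sum_eq_zero fun v hv => (AS v hv).2.1
    have DT : ∀ z ∈ T, D z = 0 := fun z hz =>
      Finset.sum_eq_zero fun v hv => by simp [hA, hST v hv z hz]
    have D0 : ∀ z, 0 ≤ D z := fun z => Finset.sum_nonneg fun v _ => (hA01 v z).1
    have Ds : ∀ z, D z ≤ S.card := fun z => by
      have : D z ≤ ∑ v ∈ S, (1 : ℤ) := Finset.sum_le_sum fun v _ => (hA01 v z).2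
      simpa using this
    have total : ∑ z, D z ^ 2 = S.card ^ 2 * γ + S.card * γ - ∑ z ∈ S, D z := by
      have : ∀ z, D z ^ 2 = ∑ v ∈ S, ∑ w ∈ S, A v z * A w z := fun z => by
        rw [sq, hD, Finset.sum_mul_sum]
      simp only [this]
      rw [Finset.sum_comm]
      have : ∀ v ∈ S, ∑ z, ∑ w ∈ S, A v z * A w z = S.card * γ + γ - ∑ w ∈ S, A v w := by
        intro v hv
        rw [Finset.sum_comm]
        simp only [hAA, Finset.sum_add_distrib, Finset.sum_sub_distrib]
        simp [hv]
        ring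
      rw [Finset.sum_congr rfl this, Finset.sum_sub_distrib, Dsum]
      simp; ring
    rw [split, Dx, Dy] at total
    set e := ∑ z ∈ Y, D z with he
    have hXe : ∑ z ∈ X, D z = e := by
      rw [he, Dsum, Dsum]
      refine Finset.sum_congr rfl fun v hv => ?_
      obtain ⟨a1, a2, a3, a4⟩ := AS v hv
      linarith [dx v a3, dy v a4]
    have hCe : ∑ z ∈ C, (S.card - D z) = e := by
      have : ∑ z ∈ C, D z + e = S.card * (γ - 1) := by
        rw [he, Dsum, Dsum, ← Finset.sum_add_distrib,
          Finset.sum_congr rfl (g := fun _ => (γ - 1 : ℤ))]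
        · simp; ring
        · intro v hv
          obtain ⟨a1, a2, a3, a4⟩ := AS v hv
          linarith [dx v a3, dy v a4]
      simp [cardC]; linarith
    have hRe : ∑ z ∈ R, (S.card - D z) = e := by
      have : ∑ z ∈ R, D z + e = S.card * γ := by
        rw [he, Dsum, Dsum, ← Finset.sum_add_distrib,
          Finset.sum_congr rfl (g := fun _ => (γ : ℤ))]
        · simp
        · intro v hv
          obtain ⟨a1, a2, a3, a4⟩ := AS v hv
          linarith [dx v a3, dy v a4, dall v]
      simp [cardR]; linarith
    have sqe : ∀ B : Finset V, ∑ z ∈ B, D z ^ 2 = ∑ z ∈ B, (S.card - D z) ^ 2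
        - 2 * S.card * ∑ z ∈ B, (S.card - D z) + B.card * S.card ^ 2 := by
      intro B
      have : (B.card : ℤ) * S.card ^ 2 = ∑ z ∈ B, (S.card : ℤ) ^ 2 := by simp
      rw [this, Finset.mul_sum, ← Finset.sum_sub_distrib, ← Finset.sum_add_distrib]
      exact Finset.sum_congr rfl fun z _ => by ring
    have hYM : ∀ f : V → ℤ, (∀ z ∈ T, f z = 0) → ∑ z ∈ Y, f z = ∑ z ∈ Y \ T, f z := by
      intro f hf
      rw [← Finset.sum_sdiff hTY, Finset.sum_eq_zero hf, add_zero]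
    have hMe : ∑ z ∈ Y \ T, D z = e := (hYM _ DT).symm
    have hMq := hYM (fun z => D z ^ 2) (fun z hz => by simp [DT z hz])
    have hXq : ∑ z ∈ X \ S, D z ^ 2 + ∑ z ∈ S, D z ^ 2 = ∑ z ∈ X, D z ^ 2 :=
      Finset.sum_sdiff hSX
    have hXs : ∑ z ∈ X \ S, D z + ∑ z ∈ S, D z = e := hXe ▸ Finset.sum_sdiff hSX
    rw [sqe C, sqe R, hCe, hRe, cardC, cardR, hMq, ← hXq] at total
    obtain ⟨bC, bC1, bC3⟩ := conf_sum_bounds C (fun z => S.card - D z)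
    obtain ⟨bR, bR1, -⟩ := conf_sum_bounds R (fun z => S.card - D z)
    obtain ⟨bM, bM1, -⟩ := conf_sum_bounds (Y \ T) D
    obtain ⟨bX, bX1, -⟩ := conf_sum_bounds X D
    obtain ⟨-, bS1, -⟩ := conf_sum_bounds S D
    obtain ⟨bO, -, -⟩ := conf_sum_bounds (X \ S) D
    simp only [hCe, hRe, hMe, hXe, cardC, cardR, cardM, cardX, cardO] at bC bC1 bC3 bR bR1 bM bM1 bX bX1 bO
    have hem : e ≤ S.card * (S.card - 1) := by
      rw [← hMe, mul_comm, ← cardM]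
      have : ∑ z ∈ Y \ T, D z ≤ ∑ z ∈ Y \ T, (S.card : ℤ) := Finset.sum_le_sum fun z _ => Ds z
      simpa using this
    have hO0 : 0 ≤ ∑ z ∈ X \ S, D z := Finset.sum_nonneg fun z _ => D0 z
    refine conf_numeric S.card T.card γ e (∑ z ∈ S, D z) _ _ _ (∑ z ∈ S, D z ^ 2) (∑ z ∈ X \ S, D z ^ 2)
      (by exact_mod_cast hs) (by exact_mod_cast hle) (by exact_mod_cast hcard)
      (Finset.sum_nonneg fun z _ => D0 z) (Finset.sum_nonneg fun z _ => D0 z)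
      (by linarith) hem ?_ bC bC1 bC3 bR bR1 bM bM1 ?_ ?_ bS1 ?_
    · linarith
    · rw [add_comm, hXq]; exact bX
    · rw [add_comm, hXq]; exact bX1
    · rw [← hXs, add_sub_cancel_right]; exact bO

end ConfAux

theorem conference_graph_local_perfect_matching
    {V : Type*} [Fintype V] (G : SimpleGraph V) [DecidableRel G.Adj]
    (γ : ℕ) (hγ : 2 ≤ γ)
    (hsrg : G.IsSRGWith (4 * γ + 1) (2 * γ) (γ - 1) γ)
    (x y : V) (hxy : G.Adj x y) :
    ∃ φ : {z : V // G.Adj x z ∧ ¬ G.Adj y z ∧ z ≠ y} ≃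
          {z : V // G.Adj y z ∧ ¬ G.Adj x z ∧ z ≠ x},
      ∀ v, G.Adj v.1 (φ v).1 := by
  classical
  have hcard : ∀ x y, G.Adj x y →
      Fintype.card {z : V // G.Adj x z ∧ ¬ G.Adj y z ∧ z ≠ y} = γ := by
    intro x y hxy
    rw [Fintype.card_subtype]
    have h1 := hsrg.regular x
    rw [← G.card_neighborFinset_eq_degree] at h1
    have h2 := hsrg.of_adj x y hxy
    rw [← Set.toFinset_card] at h2
    have h3 : G.neighborFinset x = insert y ((G.commonNeighbors x y).toFinset ∪
        Finset.univ.filter fun z => G.Adj x z ∧ ¬ G.Adj y z ∧ z ≠ y) := by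
      ext z
      simp only [SimpleGraph.mem_neighborFinset, Finset.mem_insert, Finset.mem_union,
        Set.mem_toFinset, SimpleGraph.mem_commonNeighbors, Finset.mem_filter, Finset.mem_univ,
        true_and]
      by_cases hz : z = y
      · subst hz; simp [hxy]
      · simp [hz]; tauto
    rw [h3, Finset.card_insert_of_notMem, Finset.card_union_of_disjoint, h2] at h1
    · omega
    · rw [Finset.disjoint_left]
      intro z hz
      simp [SimpleGraph.mem_commonNeighbors] at hz
      simp [hz]
    · simp [SimpleGraph.mem_commonNeighbors]
  have hX := hcard x y hxy
  have hY := hcard y x hxy.symm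
  have hall : ∃ f : {z : V // G.Adj x z ∧ ¬ G.Adj y z ∧ z ≠ y} →
      {z : V // G.Adj y z ∧ ¬ G.Adj x z ∧ z ≠ x},
      Function.Injective f ∧ ∀ v, f v ∈ Finset.univ.filter fun w => G.Adj v.1 w.1 := by
    rw [← Finset.all_card_le_biUnion_card_iff_exists_injective]
    intro S
    by_contra hlt
    push Not at hlt
    have hSγ : S.card ≤ γ := hX ▸ Finset.card_le_univ S
    obtain ⟨M, hM1, -, hM2⟩ := Finset.exists_subsuperset_card_eq
      (Finset.subset_univ (S.biUnion fun v => Finset.univ.filter fun w :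
        {z : V // G.Adj y z ∧ ¬ G.Adj x z ∧ z ≠ x} => G.Adj v.1 w.1))
      (n := S.card - 1) (by omega) (by rw [Finset.card_univ, hY]; omega)
    have hMc : (Mᶜ).card = γ - (S.card - 1) := by rw [Finset.card_compl, hY, hM2]
    have cS : (S.map (Function.Embedding.subtype _)).card = S.card := Finset.card_map _
    have cT : ((Mᶜ).map (Function.Embedding.subtype _)).card = (Mᶜ).card := Finset.card_map _
    have hS : ∀ v ∈ S.map (Function.Embedding.subtype _),
        G.Adj x v ∧ ¬ G.Adj y v ∧ v ≠ y := by
      intro v hv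
      obtain ⟨a, -, rfl⟩ := Finset.mem_map.mp hv
      exact a.2
    have hT : ∀ v ∈ (Mᶜ).map (Function.Embedding.subtype _),
        G.Adj y v ∧ ¬ G.Adj x v ∧ v ≠ x := by
      intro v hv
      obtain ⟨a, -, rfl⟩ := Finset.mem_map.mp hv
      exact a.2
    have hST : ∀ v ∈ S.map (Function.Embedding.subtype _),
        ∀ w ∈ (Mᶜ).map (Function.Embedding.subtype _), ¬ G.Adj v w := by
      intro v hv w hw hvw
      obtain ⟨a, ha, rfl⟩ := Finset.mem_map.mp hv
      obtain ⟨b, hb, rfl⟩ := Finset.mem_map.mp hw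
      refine (Finset.mem_compl.mp hb) (hM1 ?_)
      exact Finset.mem_biUnion.mpr ⟨a, ha, by simpa using hvw⟩
    rcases le_total S.card (Mᶜ).card with h | h
    · exact conf_core G γ hγ hsrg x y hxy _ _ hS hT hST (by omega) (by omega) (by omega)
    · exact conf_core G γ hγ hsrg y x hxy.symm _ _ hT hS
        (fun v hv w hw hvw => hST w hw v hv hvw.symm) (by omega) (by omega) (by omega)
  obtain ⟨f, hf, hf2⟩ := hall
  refine ⟨Equiv.ofBijective f ((Fintype.bijective_iff_injective_and_card f).mpr
    ⟨hf, hX.trans hY.symm⟩), fun v => ?_⟩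
  simpa using hf2 v
end

section
/- Let n > 5 be a prime power with n ≡ 1 (mod 4), and let x, y ∈ GF(n) be such that x − y is a non-zero square in GF(n). Then for any subset S ⊆ GF(n) \ {x, y} with |S| ≥ (3/4)(n − 1), there exist w, z ∈ S such that x − w, w − z, and z − y are non-zero squares in GF(n), while x − z and y − w are non-squares in GF(n). -/
open Finset Polynomial

section Paley
set_option linter.unusedSimpArgs false
set_option linter.unusedSectionVars false
variable {F : Type*} [Field F] [Fintype F] [DecidableEq F]

theorem paley_char_ne_two {t : ℕ} (hc : Fintype.card F = 4 * t + 1) : ringChar F ≠ 2 := by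
  intro h
  have := FiniteField.even_card_of_char_two h
  omega

theorem paley_chi_neg_one {t : ℕ} (hc : Fintype.card F = 4 * t + 1) :
    quadraticChar F (-1) = 1 := by
  rw [quadraticChar_one_iff_isSquare (by simp), FiniteField.isSquare_neg_one_iff]
  omega

theorem paley_chi_sub_comm {t : ℕ} (hc : Fintype.card F = 4 * t + 1) (a b : F) :
    quadraticChar F (a - b) = quadraticChar F (b - a) := by
  rw [← neg_sub b a, neg_eq_neg_one_mul, map_mul, paley_chi_neg_one hc, one_mul]

theorem paley_sum_chi {t : ℕ} (hc : Fintype.card F = 4 * t + 1) (a : F) :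
    ∑ z : F, quadraticChar F (a - z) = 0 := by
  rw [← quadraticChar_sum_zero (paley_char_ne_two hc)]
  exact Fintype.sum_equiv (Equiv.subLeft a) _ _ (fun z => rfl)

theorem paley_sum_chi_one {t : ℕ} (hc : Fintype.card F = 4 * t + 1) :
    ∑ z : F, quadraticChar F z * quadraticChar F (1 - z) = -1 := by
  have h := jacobiSum_nontrivial_inv (quadraticChar_ne_one (paley_char_ne_two hc))
  rw [(quadraticChar_isQuadratic F).inv, paley_chi_neg_one hc] at h
  exact h

theorem paley_sum_chi_mul {t : ℕ} (hc : Fintype.card F = 4 * t + 1) (a b : F) :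
    ∑ z : F, quadraticChar F (a - z) * quadraticChar F (b - z)
      = (if a = b then (Fintype.card F : ℤ) else 0) - 1 := by
  split_ifs with h
  · subst h
    have : ∀ z : F, quadraticChar F (a - z) * quadraticChar F (a - z)
        = 1 - (if z = a then 1 else 0) := by
      intro z
      split_ifs with h
      · simp [h]
      · rw [← pow_two, quadraticChar_sq_one (sub_ne_zero.2 (Ne.symm h))]; rfl
    simp_rw [this, Finset.sum_sub_distrib]
    simp
  · rw [zero_sub, ← paley_sum_chi_one hc]
    have hd : b - a ≠ 0 := sub_ne_zero.2 (Ne.symm h)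
    symm
    refine Fintype.sum_equiv
      ((Equiv.mulLeft₀ (b - a) hd).trans (Equiv.addLeft a)) _ _ (fun z => ?_)
    change _ = quadraticChar F (a - (a + (b - a) * z)) * quadraticChar F (b - (a + (b - a) * z))
    rw [paley_chi_sub_comm hc a, show a + (b - a) * z - a = (b - a) * z by ring,
      show b - (a + (b - a) * z) = (b - a) * (1 - z) by ring, map_mul, map_mul]
    have := quadraticChar_sq_one hd
    linear_combination (-quadraticChar F z * quadraticChar F (1 - z)) * this

/-- Second moment identity (the eigenvalues of the Paley graph). -/
theorem paley_second_moment {t : ℕ} (hc : Fintype.card F = 4 * t + 1) (u : F → ℤ) :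
    ∑ z : F, (∑ p : F, u p * quadraticChar F (p - z)) ^ 2
      = Fintype.card F * ∑ p, u p ^ 2 - (∑ p, u p) ^ 2 := by
  have h1 : ∀ z : F, (∑ p : F, u p * quadraticChar F (p - z)) ^ 2
      = ∑ p : F, ∑ q : F, u p * u q * (quadraticChar F (p - z) * quadraticChar F (q - z)) := by
    intro z
    rw [pow_two, Finset.sum_mul_sum]
    refine Finset.sum_congr rfl fun p _ => Finset.sum_congr rfl fun q _ => by ring
  simp_rw [h1]
  rw [Finset.sum_comm]
  have h2 : ∀ p : F, ∑ z : F, ∑ q : F, u p * u q *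
      (quadraticChar F (p - z) * quadraticChar F (q - z))
      = Fintype.card F * u p ^ 2 - u p * ∑ q, u q := by
    intro p
    rw [Finset.sum_comm]
    simp_rw [← Finset.mul_sum, paley_sum_chi_mul hc, mul_sub, Finset.sum_sub_distrib, mul_one,
      ← Finset.mul_sum]
    congr 1
    simp
    ring
  simp_rw [h2, Finset.sum_sub_distrib, ← Finset.mul_sum, ← Finset.sum_mul]
  ring

theorem paley_first_moment {t : ℕ} (hc : Fintype.card F = 4 * t + 1) (u : F → ℤ) :
    ∑ z : F, (∑ p : F, u p * quadraticChar F (p - z)) = 0 := by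
  rw [Finset.sum_comm]
  simp_rw [← Finset.mul_sum, paley_sum_chi hc]
  simp

/-- Spectral bound. -/
theorem paley_spectral {t : ℕ} (hc : Fintype.card F = 4 * t + 1) (x y : F) (A B : Finset F)
    (hxy : x ≠ y) (hxA : x ∉ A) (hyA : y ∉ A)
    (hBx : ∀ z ∈ B, quadraticChar F (x - z) = -1)
    (hBy : ∀ z ∈ B, quadraticChar F (y - z) = 1)
    (hAB : ∀ w ∈ A, ∀ z ∈ B, quadraticChar F (w - z) = -1) :
    (B.card : ℤ) * (A.card + 2) ^ 2 * (4 * t + 1)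
      ≤ (4 * t + 1 - B.card) * ((4 * t + 1) * (A.card + 2) - A.card ^ 2) := by
  set u : F → ℤ := fun p => (if p ∈ A then 1 else 0) + (if p = x then 1 else 0)
    - (if p = y then 1 else 0) with hu
  have hsum : ∑ p, u p = A.card := by
    simp [hu, Finset.sum_add_distrib, Finset.sum_sub_distrib]
  have hsq : ∑ p, u p ^ 2 = A.card + 2 := by
    have : ∀ p, u p ^ 2 = (if p ∈ A then 1 else 0) + (if p = x then 1 else 0)
        + (if p = y then 1 else 0) := by
      intro p
      simp only [hu]
      split_ifs <;> simp_all
    simp_rw [this]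
    simp [Finset.sum_add_distrib]
    ring
  set g : F → ℤ := fun z => ∑ p : F, u p * quadraticChar F (p - z) with hg
  have m1 : ∑ z, g z = 0 := paley_first_moment hc u
  have m2 : ∑ z, g z ^ 2 = _ := paley_second_moment hc u
  have hgB : ∀ z ∈ B, g z = -(A.card + 2) := by
    intro z hz
    have : g z = ∑ p ∈ A, quadraticChar F (p - z) + quadraticChar F (x - z)
        - quadraticChar F (y - z) := by
      simp [hg, hu, add_mul, sub_mul, Finset.sum_add_distrib, Finset.sum_sub_distrib]
    rw [this, hBx z hz, hBy z hz, Finset.sum_congr rfl (fun w hw => hAB w hw z hz)]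
    simp
    ring
  have s1 : ∑ z ∈ B, g z = -(B.card * (A.card + 2)) := by
    rw [Finset.sum_congr rfl hgB]; simp; ring
  have s2 : ∑ z ∈ B, g z ^ 2 = B.card * (A.card + 2) ^ 2 := by
    rw [Finset.sum_congr rfl (fun z hz => by rw [hgB z hz])]; simp
    left; ring
  have c1 := Finset.sum_add_sum_compl B g
  have c2 := Finset.sum_add_sum_compl B (fun z => g z ^ 2)
  have c3 := sq_sum_le_card_mul_sum_sq (s := Bᶜ) (f := g)
  have c4 : ((Bᶜ).card : ℤ) = 4 * t + 1 - B.card := by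
    have := Finset.card_add_card_compl B
    rw [hc] at this
    have h : ((B.card + (Bᶜ).card : ℕ) : ℤ) = ((4 * t + 1 : ℕ) : ℤ) := by rw [this]
    push_cast at h
    linarith
  rw [m1, s1] at c1
  rw [m2, s2, hsq, hsum, hc] at c2
  have e1 : ∑ z ∈ Bᶜ, g z = B.card * (A.card + 2) := by linarith
  have e2 : ∑ z ∈ Bᶜ, g z ^ 2 = (4 * t + 1) * (A.card + 2) - A.card ^ 2
      - B.card * (A.card + 2) ^ 2 := by push_cast at c2; linarith
  rw [e1, e2, c4] at c3
  nlinarith [c3]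

theorem paley_arith (t a b : ℤ) (ht : 6 ≤ t) (ha : 2 ≤ a) (hab : a ≤ b) (hs : t + 1 ≤ a + b)
    (hbt : b ≤ t)
    (h : b * (a + 2) ^ 2 * (4 * t + 1)
      ≤ (4 * t + 1 - b) * ((4 * t + 1) * (a + 2) - a ^ 2)) : False := by
  rcases le_or_gt 8 t with h8 | h8
  · have h1 : b * (a + 3) ≤ 4 * t + 1 := by
      by_contra hcon
      push Not at hcon
      have hp : 0 < (4 * t + 1) * (a + 2) := by positivity
      have := mul_lt_mul_of_pos_left hcon hp
      have h5 : 0 ≤ (4 * t + 1 - b) * a ^ 2 := mul_nonneg (by linarith) (sq_nonneg a)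
      nlinarith
    rcases le_or_gt (2 * a) (t + 1) with h2 | h2
    · have : (t + 1 - a) * (a + 3) ≤ 4 * t + 1 :=
        le_trans (mul_le_mul_of_nonneg_right (by linarith) (by linarith)) h1
      nlinarith
    · nlinarith
  · have : b ≤ 7 := by linarith
    have : a ≤ 7 := by linarith
    interval_cases t <;> interval_cases a <;> interval_cases b <;> omega

theorem paley_power_sum {i : ℕ} (hi : 0 < i) :
    ∑ z : F, z ^ i = if Fintype.card F - 1 ∣ i then -1 else 0 := by
  rw [← FiniteField.sum_pow_units F i]
  rw [← Finset.sum_sdiff (Finset.subset_univ ({0} : Finset F))]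
  rw [Finset.sum_singleton, zero_pow hi.ne', add_zero]
  symm
  refine Finset.sum_bij (fun (u : Fˣ) _ => (u : F)) (by simp) ?_ ?_ (by simp)
  · intro a _ b _ h; exact Units.ext h
  · intro b hb
    have : b ≠ 0 := by simpa using hb
    exact ⟨Units.mk0 b this, by simp, rfl⟩

/-- If the cubic takes only square values we get a contradiction. -/
theorem paley_cubic {t : ℕ} (ht : 2 ≤ t) (hc : Fintype.card F = 4 * t + 1) (h2 : (2 : F) ≠ 0)
    (w : F) (hw : w ^ (2 * t) = -1) (hw1 : w ≠ 1)
    (hf : ∀ z : F, z ≠ 0 → z ≠ 1 → z ≠ w → (z * ((1 - z) * (w - z))) ^ (2 * t) = 1) : False := by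
  have hw0 : w ≠ 0 := by
    rintro rfl
    rw [zero_pow (by omega)] at hw
    simp at hw
  set P : F[X] := (1 - X) * (C w - X) with hP
  set D : F[X] := P ^ (2 * t) with hD
  have hPdeg : P.natDegree ≤ 2 := by
    rw [hP]; compute_degree
  have hDdeg : D.natDegree < 4 * t + 1 := by
    have := natDegree_pow_le_of_le (2 * t) hPdeg
    rw [← hD] at this
    omega
  have key : ∀ i : ℕ, 0 < i → i < 4 → D.coeff i = 1 + w ^ (2 * t - i) := by
    intro i hi hi4
    have l1 : ∑ z : F, z ^ (4 * t - i) * D.eval z = - D.coeff i := by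
      simp_rw [eval_eq_sum_range' hDdeg, Finset.mul_sum]
      rw [Finset.sum_comm]
      have : ∀ k ∈ Finset.range (4 * t + 1), ∑ z : F, z ^ (4 * t - i) * (D.coeff k * z ^ k)
          = if k = i then - D.coeff i else 0 := by
        intro k hk
        rw [Finset.mem_range] at hk
        have e : ∀ z : F, z ^ (4 * t - i) * (D.coeff k * z ^ k)
            = D.coeff k * z ^ (4 * t - i + k) := by intro z; rw [pow_add]; ring
        simp_rw [e, ← Finset.mul_sum]
        rw [paley_power_sum (by omega), hc]
        simp only [Nat.add_sub_cancel]
        by_cases hki : k = i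
        · subst hki
          rw [if_pos ⟨1, by omega⟩, if_pos rfl]; ring
        · rw [if_neg, if_neg hki, mul_zero]
          rintro ⟨m, hm⟩
          have : m < 2 := by
            by_contra hcon
            have : 4 * t * 2 ≤ 4 * t * m := Nat.mul_le_mul_left _ (by omega)
            omega
          interval_cases m <;> omega
      rw [Finset.sum_congr rfl this]
      rw [Finset.sum_ite_eq' , if_pos (Finset.mem_range.2 (by omega))]
    have l2 : ∀ z : F, z ^ (4 * t - i) * D.eval z
        = z ^ (2 * t - i) - (if z = 1 then 1 else 0) - (if z = w then w ^ (2 * t - i) else 0) := by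
      intro z
      have hev : D.eval z = ((1 - z) * (w - z)) ^ (2 * t) := by
        simp [hD, hP]
      rw [hev, show 4 * t - i = (2 * t - i) + 2 * t by omega, pow_add, mul_assoc, ← mul_pow]
      by_cases z0 : z = 0
      · subst z0
        rw [if_neg (by simp), if_neg (Ne.symm hw0), zero_mul, zero_pow (by omega : 2 * t ≠ 0),
          zero_pow (by omega : 2 * t - i ≠ 0)]
        ring
      by_cases z1 : z = 1
      · subst z1
        rw [if_pos rfl, if_neg (Ne.symm hw1)]
        simp; omega
      by_cases zw : z = w
      · subst zw
        rw [if_neg z1, if_pos rfl]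
        simp; omega
      rw [hf z z0 z1 zw]
      simp [z1, zw]
    simp_rw [l2, Finset.sum_sub_distrib] at l1
    rw [FiniteField.sum_pow_lt_card_sub_one F _ (by rw [hc]; omega)] at l1
    simp only [Finset.sum_ite_eq', Finset.mem_univ, if_true] at l1
    linear_combination l1
  have k1 := key 1 (by norm_num) (by norm_num)
  have k2 := key 2 (by norm_num) (by norm_num)
  have k3 := key 3 (by norm_num) (by norm_num)
  have k0 : D.coeff 0 = -1 := by
    rw [coeff_zero_eq_eval_zero]; simp [hD, hP, hw]
  have r1 : w ^ (2 * t - 1) * w = -1 := by rw [← pow_succ, ← hw]; congr 1; omega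
  have r2 : w ^ (2 * t - 2) * w ^ 2 = -1 := by rw [← pow_add, ← hw]; congr 1; omega
  have r3 : w ^ (2 * t - 3) * w ^ 3 = -1 := by rw [← pow_add, ← hw]; congr 1; omega
  set v := w⁻¹ with hv
  have hvw : w * v = 1 := mul_inv_cancel₀ hw0
  have hwv : w = v⁻¹ := by rw [hv, inv_inv]
  have hv0 : v ≠ 0 := inv_ne_zero hw0
  have q1 : w ^ (2 * t - 1) = -v := by
    apply mul_right_cancel₀ hw0; rw [r1]; linear_combination hvw
  have q2 : w ^ (2 * t - 2) = -v ^ 2 := by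
    apply mul_right_cancel₀ (pow_ne_zero 2 hw0); rw [r2]
    linear_combination (w * v + 1) * hvw
  have q3 : w ^ (2 * t - 3) = -v ^ 3 := by
    apply mul_right_cancel₀ (pow_ne_zero 3 hw0); rw [r3]
    linear_combination (w ^ 2 * v ^ 2 + w * v + 1) * hvw
  rw [q1] at k1
  rw [q2] at k2
  rw [q3] at k3
  have hDP : D * D * P = expand F (4 * t + 1) P := by
    rw [← hc, FiniteField.expand_card, hc, hD]; ring
  have p0 : P.coeff 0 = w := by rw [coeff_zero_eq_eval_zero]; simp [hP]
  have hPe : P = C w - C (1 + w) * X + X ^ 2 := by rw [hP, C_add, C_1]; ring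
  have p1 : P.coeff 1 = -(1 + w) := by
    rw [hPe]; simp [coeff_X, coeff_C, coeff_X_pow, -map_add]
  have p2 : P.coeff 2 = 1 := by
    rw [hPe]; simp [coeff_X, coeff_C, coeff_X_pow, -map_add]
  have p3 : P.coeff 3 = 0 := by
    rw [hPe]; simp [coeff_X, coeff_C, coeff_X_pow, -map_add]
  have z1 : (D * D * P).coeff 1 = 0 := by
    rw [hDP, coeff_expand (by omega), if_neg]
    intro h; have := Nat.le_of_dvd (by norm_num) h; omega
  have z3 : (D * D * P).coeff 3 = 0 := by
    rw [hDP, coeff_expand (by omega), if_neg]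
    intro h; have := Nat.le_of_dvd (by norm_num) h; omega
  simp [coeff_mul, Finset.Nat.antidiagonal_succ, k0, k1, k2, k3, p0, p1, p2, p3] at z1 z3
  have y1 : v = 3 := by
    linear_combination v * z1 - (2*v-3) * hvw
  have y3 : (v - 1) ^ 2 * (v + 1) = 0 := by
    linear_combination v * z3 - (4*v^3 - 2*v^2 - 2*v - (-1-2*v+3*v^2)) * hvw
  rw [y1] at y3
  have : (2 : F) ^ 4 = 0 := by linear_combination y3
  exact h2 (pow_eq_zero_iff (by norm_num) |>.1 this)

theorem paley_degree {t : ℕ} (ht : 2 ≤ t) (hc : Fintype.card F = 4 * t + 1)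
    (w : F) (hw : quadraticChar F w = -1) (hw1 : quadraticChar F (1 - w) = 1)
    (H : ∀ z : F, quadraticChar F z = 1 → quadraticChar F (1 - z) = -1 →
      quadraticChar F (w - z) = -1) : False := by
  have hchar := paley_char_ne_two hc
  have n1 : w ≠ 1 := by rintro rfl; simp at hw1
  have n0 : w ≠ 0 := by rintro rfl; simp at hw
  have h0 : ∀ z : F, quadraticChar F (0 - z) = quadraticChar F z := by
    intro z; rw [paley_chi_sub_comm hc, sub_zero]
  have tri : ∀ z : F, z ≠ 0 → quadraticChar F z = 1 ∨ quadraticChar F z = -1 :=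
    fun z hz => quadraticChar_dichotomy hz
  have S : ∀ z : F, (1 + quadraticChar F (0 - z)) * (1 - quadraticChar F (1 - z)) *
      (1 + quadraticChar F (w - z)) = if z = 1 then 4 else 0 := by
    intro z
    rw [h0]
    by_cases z0 : z = 0
    · subst z0; rw [sub_zero, map_one, if_neg (by simp)]; ring
    by_cases z1 : z = 1
    · subst z1; rw [paley_chi_sub_comm hc w, hw1, sub_self, map_one, quadraticChar_zero]; norm_num
    by_cases zw : z = w
    · subst zw; rw [hw, if_neg z1]; ring
    rw [if_neg z1]
    rcases tri z z0 with a | a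
    · rcases tri (1 - z) (sub_ne_zero.2 (Ne.symm z1)) with b | b
      · rw [b]; ring
      · rw [H z a b]; ring
    · rw [a]; ring
  have S' : ∑ z : F, (1 + quadraticChar F (0 - z)) * (1 - quadraticChar F (1 - z)) *
      (1 + quadraticChar F (w - z)) = 4 := by
    simp_rw [S]; simp
  have E : ∀ z : F, (1 + quadraticChar F (0 - z)) * (1 - quadraticChar F (1 - z)) *
      (1 + quadraticChar F (w - z)) = 1 + quadraticChar F (0 - z) - quadraticChar F (1 - z)
      + quadraticChar F (w - z) - quadraticChar F (0 - z) * quadraticChar F (1 - z)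
      + quadraticChar F (0 - z) * quadraticChar F (w - z)
      - quadraticChar F (1 - z) * quadraticChar F (w - z)
      - quadraticChar F (0 - z) * quadraticChar F (1 - z) * quadraticChar F (w - z) := by
    intro z; ring
  simp_rw [E, Finset.sum_sub_distrib, Finset.sum_add_distrib, Finset.sum_sub_distrib,
    Finset.sum_add_distrib, Finset.sum_sub_distrib, Finset.sum_add_distrib] at S'
  rw [paley_sum_chi hc, paley_sum_chi hc, paley_sum_chi hc, paley_sum_chi_mul hc,
    paley_sum_chi_mul hc, paley_sum_chi_mul hc, if_neg (by simp), if_neg (Ne.symm n0),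
    if_neg (Ne.symm n1)] at S'
  rw [Finset.sum_const, Finset.card_univ, nsmul_eq_mul, mul_one] at S'
  set T : F → ℤ := fun z => 1 - (if z = 0 then 1 else 0) - (if z = 1 then 1 else 0)
    - (if z = w then 1 else 0)
    - quadraticChar F (0 - z) * quadraticChar F (1 - z) * quadraticChar F (w - z) with hT
  have T0 : ∑ z, T z = 0 := by
    simp_rw [hT, Finset.sum_sub_distrib]
    simp only [Finset.sum_ite_eq', Finset.mem_univ, if_true]
    rw [Finset.sum_const, Finset.card_univ, nsmul_eq_mul, mul_one]
    linarith
  have Tval : ∀ z, z ≠ 0 → z ≠ 1 → z ≠ w → T z = 1 - quadraticChar F (z * ((1 - z) * (w - z))) := by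
    intro z z0 z1 zw
    simp only [hT, h0, map_mul, if_neg z0, if_neg z1, if_neg zw]
    ring
  have Tnn : ∀ z ∈ (Finset.univ : Finset F), 0 ≤ T z := by
    intro z _
    by_cases z0 : z = 0
    · subst z0; simp [hT, Ne.symm n0]
    by_cases z1 : z = 1
    · subst z1; simp [hT, Ne.symm n1]
    by_cases zw : z = w
    · subst zw; simp [hT, n0, n1]
    rw [Tval z z0 z1 zw]
    rcases tri (z * ((1 - z) * (w - z))) (mul_ne_zero z0 (mul_ne_zero
      (sub_ne_zero.2 (Ne.symm z1)) (sub_ne_zero.2 (Ne.symm zw)))) with a | a <;> rw [a] <;> norm_num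
  have Tz := (Finset.sum_eq_zero_iff_of_nonneg Tnn).1 T0
  have hhalf : Fintype.card F / 2 = 2 * t := by omega
  refine paley_cubic ht hc (Ring.two_ne_zero hchar) w ?_ n1 ?_
  · have := quadraticChar_eq_pow_of_char_ne_two' hchar w
    rw [hhalf, hw] at this
    simpa using this.symm
  · intro z z0 z1 zw
    have h := Tz z (Finset.mem_univ z)
    rw [Tval z z0 z1 zw] at h
    have h' : quadraticChar F (z * ((1 - z) * (w - z))) = 1 := by linarith
    have := quadraticChar_eq_pow_of_char_ne_two' hchar (z * ((1 - z) * (w - z)))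
    rw [hhalf, h'] at this
    simpa using this.symm

theorem paley_card_Nx {t : ℕ} (hc : Fintype.card F = 4 * t + 1) :
    (Finset.univ.filter (fun w : F => quadraticChar F w = -1 ∧ quadraticChar F (1 - w) = 1)).card
      = t := by
  have h0 : ∀ z : F, quadraticChar F (0 - z) = quadraticChar F z := by
    intro z; rw [paley_chi_sub_comm hc, sub_zero]
  have S : ∀ z : F, (1 - quadraticChar F (0 - z)) * (1 + quadraticChar F (1 - z))
      = (if z = 0 then 2 else 0) +
        4 * (if quadraticChar F z = -1 ∧ quadraticChar F (1 - z) = 1 then 1 else 0) := by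
    intro z
    rw [h0]
    by_cases z0 : z = 0
    · subst z0; simp
    by_cases z1 : z = 1
    · subst z1; simp
    rcases quadraticChar_dichotomy z0 with a | a <;>
    rcases quadraticChar_dichotomy (sub_ne_zero.2 (Ne.symm z1)) with b | b <;>
    rw [a, b] <;> simp [z0]
  have E : ∀ z : F, (1 - quadraticChar F (0 - z)) * (1 + quadraticChar F (1 - z))
      = 1 - quadraticChar F (0 - z) + quadraticChar F (1 - z)
        - quadraticChar F (0 - z) * quadraticChar F (1 - z) := by intro z; ring
  have S1 : ∑ z : F, (1 - quadraticChar F (0 - z)) * (1 + quadraticChar F (1 - z))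
      = 4 * t + 2 := by
    simp_rw [E, Finset.sum_sub_distrib, Finset.sum_add_distrib, Finset.sum_sub_distrib]
    rw [paley_sum_chi hc, paley_sum_chi hc, paley_sum_chi_mul hc, if_neg (by simp),
      Finset.sum_const, Finset.card_univ, nsmul_eq_mul, mul_one, hc]
    push_cast; ring
  simp_rw [S, Finset.sum_add_distrib, ← Finset.mul_sum] at S1
  rw [Finset.sum_ite_eq', if_pos (Finset.mem_univ _), Finset.sum_boole] at S1
  have : ((Finset.univ.filter (fun w : F => quadraticChar F w = -1 ∧
    quadraticChar F (1 - w) = 1)).card : ℤ) = t := by linarith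
  exact_mod_cast this

theorem paley_card_Ny {t : ℕ} (hc : Fintype.card F = 4 * t + 1) :
    (Finset.univ.filter (fun z : F => quadraticChar F z = 1 ∧ quadraticChar F (1 - z) = -1)).card
      = t := by
  rw [← paley_card_Nx hc]
  refine Finset.card_bij (fun z _ => 1 - z) ?_ ?_ ?_
  · intro z hz
    simpa [and_comm] using hz
  · intro a _ b _ h
    simpa using h
  · intro b hb
    exact ⟨1 - b, by simpa [and_comm] using hb, by simp⟩

theorem paley_matching {t : ℕ} (hc : Fintype.card F = 4 * t + 1) (A B : Finset F) (f g : F → F)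
    (hf : ∀ w, quadraticChar F w = -1 → quadraticChar F (1 - w) = 1 →
      quadraticChar F (f w) = 1 ∧ quadraticChar F (1 - f w) = -1 ∧
      quadraticChar F (w - f w) = 1 ∧ g (f w) = w)
    (hA : ∀ w ∈ A, quadraticChar F w = -1 ∧ quadraticChar F (1 - w) = 1)
    (hB : ∀ z ∈ B, quadraticChar F z = 1 ∧ quadraticChar F (1 - z) = -1)
    (hAB : ∀ w ∈ A, ∀ z ∈ B, quadraticChar F (w - z) = -1)
    (hs : t + 1 ≤ A.card + B.card) : False := by
  have h1 : (A.image f).card = A.card := by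
    refine Finset.card_image_of_injOn ?_
    intro a ha b hb h
    have e1 := (hf a (hA a ha).1 (hA a ha).2).2.2.2
    have e2 := (hf b (hA b hb).1 (hA b hb).2).2.2.2
    have h' : f a = f b := h
    rw [← e1, ← e2, h']
  have h2 : Disjoint (A.image f) B := by
    rw [Finset.disjoint_left]
    intro z hz hzB
    obtain ⟨w, hw, rfl⟩ := Finset.mem_image.1 hz
    have := hAB w hw _ hzB
    rw [(hf w (hA w hw).1 (hA w hw).2).2.2.1] at this
    norm_num at this
  have h3 : A.image f ∪ B ⊆
      Finset.univ.filter (fun z : F => quadraticChar F z = 1 ∧ quadraticChar F (1 - z) = -1) := by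
    intro z hz
    rw [Finset.mem_filter]
    refine ⟨Finset.mem_univ _, ?_⟩
    rcases Finset.mem_union.1 hz with h | h
    · obtain ⟨w, hw, rfl⟩ := Finset.mem_image.1 h
      have := hf w (hA w hw).1 (hA w hw).2
      exact ⟨this.1, this.2.1⟩
    · exact hB z h
  have h4 := Finset.card_le_card h3
  rw [Finset.card_union_of_disjoint h2, h1, paley_card_Ny hc] at h4
  omega

theorem paley_chi_equiv {K : Type*} [Field K] [Fintype K] [DecidableEq K] (e : K ≃+* F) (a : K) :
    quadraticChar F (e a) = quadraticChar K a := by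
  by_cases h : a = 0
  · subst h; simp
  have h' : e a ≠ 0 := by simpa using h
  by_cases hs : IsSquare a
  · rw [(quadraticChar_one_iff_isSquare h).2 hs, (quadraticChar_one_iff_isSquare h').2 (hs.map e)]
  · rw [quadraticChar_neg_one_iff_not_isSquare.2 hs, quadraticChar_neg_one_iff_not_isSquare.2]
    intro hh
    apply hs
    simpa using hh.map e.symm

theorem paley_small {t p : ℕ} (hc : Fintype.card F = 4 * t + 1) (A B : Finset F)
    [hp : Fact p.Prime] (hpt : p = 4 * t + 1) (f g : ZMod p → ZMod p)
    (hf : ∀ w, quadraticChar (ZMod p) w = -1 → quadraticChar (ZMod p) (1 - w) = 1 →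
      quadraticChar (ZMod p) (f w) = 1 ∧ quadraticChar (ZMod p) (1 - f w) = -1 ∧
      quadraticChar (ZMod p) (w - f w) = 1 ∧ g (f w) = w)
    (hA : ∀ w ∈ A, quadraticChar F w = -1 ∧ quadraticChar F (1 - w) = 1)
    (hB : ∀ z ∈ B, quadraticChar F z = 1 ∧ quadraticChar F (1 - z) = -1)
    (hAB : ∀ w ∈ A, ∀ z ∈ B, quadraticChar F (w - z) = -1)
    (hs : t + 1 ≤ A.card + B.card) : False := by
  let e : ZMod p ≃+* F := ZMod.ringEquivOfPrime F hp.out (hc.trans hpt.symm)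
  refine paley_matching hc A B (fun w => e (f (e.symm w))) (fun w => e (g (e.symm w))) ?_
    hA hB hAB hs
  intro w h1 h2
  obtain ⟨v, rfl⟩ := e.surjective w
  have hsub : ∀ a b, e a - e b = e (a - b) := fun a b => (map_sub e a b).symm
  have hone : (1 : F) = e 1 := (map_one e).symm
  simp only [RingEquiv.symm_apply_apply, hone, hsub, paley_chi_equiv] at h1 h2 ⊢
  obtain ⟨a, b, c, d⟩ := hf v h1 h2
  exact ⟨a, b, c, by rw [d]⟩

instance paley_fact13 : Fact (Nat.Prime 13) := ⟨by norm_num⟩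

instance paley_fact17 : Fact (Nat.Prime 17) := ⟨by norm_num⟩

theorem paley_core {t : ℕ} (ht : 2 ≤ t) (hc : Fintype.card F = 4 * t + 1) (A B : Finset F)
    (hA : ∀ w ∈ A, quadraticChar F w = -1 ∧ quadraticChar F (1 - w) = 1)
    (hB : ∀ z ∈ B, quadraticChar F z = 1 ∧ quadraticChar F (1 - z) = -1)
    (hAB : ∀ w ∈ A, ∀ z ∈ B, quadraticChar F (w - z) = -1)
    (hs : t + 1 ≤ A.card + B.card) : False := by
  have h0 : ∀ z : F, quadraticChar F (0 - z) = quadraticChar F z := by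
    intro z; rw [paley_chi_sub_comm hc, sub_zero]
  have hAs : A ⊆ Finset.univ.filter
      (fun w : F => quadraticChar F w = -1 ∧ quadraticChar F (1 - w) = 1) := by
    intro w hw; simpa using hA w hw
  have hBs : B ⊆ Finset.univ.filter
      (fun w : F => quadraticChar F w = 1 ∧ quadraticChar F (1 - w) = -1) := by
    intro w hw; simpa using hB w hw
  have hAt := Finset.card_le_card hAs
  have hBt := Finset.card_le_card hBs
  rw [paley_card_Nx hc] at hAt
  rw [paley_card_Ny hc] at hBt
  by_cases hb : B.card = t
  · have hBe := Finset.eq_of_subset_of_card_le hBs (by rw [paley_card_Ny hc, hb])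
    obtain ⟨w, hw⟩ : A.Nonempty := Finset.card_pos.1 (by omega)
    refine paley_degree ht hc w (hA w hw).1 (hA w hw).2 fun z h1 h2 => hAB w hw z ?_
    rw [hBe]; exact Finset.mem_filter.2 ⟨Finset.mem_univ _, h1, h2⟩
  by_cases ha : A.card = t
  · have hAe := Finset.eq_of_subset_of_card_le hAs (by rw [paley_card_Nx hc, ha])
    obtain ⟨z, hz⟩ : B.Nonempty := Finset.card_pos.1 (by omega)
    refine paley_degree ht hc (1 - z) (hB z hz).2 (by simpa using (hB z hz).1) fun v h1 h2 => ?_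
    rw [show 1 - z - v = (1 - v) - z by ring]
    refine hAB (1 - v) ?_ z hz
    rw [hAe]; exact Finset.mem_filter.2 ⟨Finset.mem_univ _, h2, by rwa [sub_sub_cancel]⟩
  have hA0 : (0 : F) ∉ A := fun h => by simpa using (hA 0 h).1
  have hA1 : (1 : F) ∉ A := fun h => by simpa using (hA 1 h).2
  have hB0 : (0 : F) ∉ B := fun h => by simpa using (hB 0 h).1
  have hB1 : (1 : F) ∉ B := fun h => by simpa using (hB 1 h).2
  by_cases ht6 : 6 ≤ t
  · rcases le_total A.card B.card with hle | hle
    · have := paley_spectral hc 1 0 A B one_ne_zero hA1 hA0 (fun z hz => (hB z hz).2)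
        (fun z hz => by rw [h0]; exact (hB z hz).1) hAB
      exact paley_arith t A.card B.card (by omega) (by omega) (by omega) (by omega) (by omega) this
    · have := paley_spectral hc 0 1 B A zero_ne_one hB0 hB1
        (fun z hz => by rw [h0]; exact (hA z hz).1) (fun z hz => (hA z hz).2)
        (fun w hw z hz => by rw [paley_chi_sub_comm hc]; exact hAB z hz w hw)
      exact paley_arith t B.card A.card (by omega) (by omega) (by omega) (by omega) (by omega) this
  have : 3 ≤ t := by omega
  have : t ≤ 5 := by omega
  interval_cases t
  · exact paley_small hc A B (p := 13) rfl
      (fun w => if w = 2 then 3 else if w = 5 then 9 else 12)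
      (fun w => if w = 3 then 2 else if w = 9 then 5 else 11) (by decide) hA hB hAB hs
  · exact paley_small hc A B (p := 17) rfl
      (fun w => if w = 3 then 4 else if w = 5 then 13 else if w = 10 then 8 else 15)
      (fun w => if w = 4 then 3 else if w = 13 then 5 else if w = 8 then 10 else 14) (by decide) hA hB hAB hs
  · have hpp := FiniteField.isPrimePow_card F
    rw [hc] at hpp
    obtain ⟨p, -, hpu⟩ := isPrimePow_iff_unique_prime_dvd.1 hpp
    have a := hpu 3 ⟨by norm_num, by norm_num⟩
    have b := hpu 7 ⟨by norm_num, by norm_num⟩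
    omega

theorem paley_normalized {t : ℕ} (ht : 2 ≤ t) (hc : Fintype.card F = 4 * t + 1) (S : Finset F)
    (hS0 : (0 : F) ∉ S) (hS1 : (1 : F) ∉ S) (hS : 3 * t ≤ S.card) :
    ∃ w ∈ S, ∃ z ∈ S, quadraticChar F (1 - w) = 1 ∧ quadraticChar F (w - z) = 1 ∧
      quadraticChar F z = 1 ∧ quadraticChar F (1 - z) = -1 ∧ quadraticChar F w = -1 := by
  by_contra hcon
  push Not at hcon
  set NX := Finset.univ.filter
      (fun w : F => quadraticChar F w = -1 ∧ quadraticChar F (1 - w) = 1) with hNX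
  set NY := Finset.univ.filter
      (fun w : F => quadraticChar F w = 1 ∧ quadraticChar F (1 - w) = -1) with hNY
  have cX : NX.card = t := paley_card_Nx hc
  have cY : NY.card = t := paley_card_Ny hc
  have mX : ∀ w, w ∈ NX ↔ quadraticChar F w = -1 ∧ quadraticChar F (1 - w) = 1 := by simp [hNX]
  have mY : ∀ w, w ∈ NY ↔ quadraticChar F w = 1 ∧ quadraticChar F (1 - w) = -1 := by simp [hNY]
  have dXY : Disjoint NX NY := by
    rw [Finset.disjoint_left]
    intro a h1 h2
    have := ((mX a).1 h1).1
    rw [((mY a).1 h2).1] at this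
    norm_num at this
  refine paley_core ht hc (S ∩ NX) (S ∩ NY)
    (fun w hw => (mX w).1 (Finset.mem_inter.1 hw).2)
    (fun w hw => (mY w).1 (Finset.mem_inter.1 hw).2) ?_ ?_
  · intro w hw z hz
    obtain ⟨w1, w2⟩ := Finset.mem_inter.1 hw
    obtain ⟨z1, z2⟩ := Finset.mem_inter.1 hz
    rw [mX] at w2
    rw [mY] at z2
    have hne : w - z ≠ 0 := by
      intro h
      have h' := sub_eq_zero.1 h
      rw [h', z2.1] at w2
      norm_num at w2
    rcases quadraticChar_dichotomy hne with h | h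
    · exact absurd w2.1 (hcon w w1 z z1 w2.2 h z2.1 z2.2)
    · exact h
  · have hdisj : Disjoint (S ∩ NX) (S ∩ NY) :=
      dXY.mono Finset.inter_subset_right Finset.inter_subset_right
    rw [← Finset.card_union_of_disjoint hdisj, ← Finset.inter_union_distrib_left]
    have c01 : ({0, 1} : Finset F).card = 2 := Finset.card_pair zero_ne_one
    have d1 : Disjoint ({0, 1} : Finset F) (S ∪ (NX ∪ NY)) := by
      rw [Finset.disjoint_left]
      intro a ha h
      simp only [Finset.mem_insert, Finset.mem_singleton] at ha
      simp only [Finset.mem_union, mX, mY] at h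
      rcases ha with rfl | rfl
      · simp [hS0] at h
      · simp [hS1] at h
    have c1 := Finset.card_le_univ (({0, 1} : Finset F) ∪ (S ∪ (NX ∪ NY)))
    rw [Finset.card_union_of_disjoint d1, c01, hc] at c1
    have c2 := Finset.card_union_add_card_inter S (NX ∪ NY)
    rw [Finset.card_union_of_disjoint dXY, cX, cY] at c2
    omega
end Paley

theorem paley_quadratic_residue_matching
    (F : Type*) [Field F] [Fintype F] [DecidableEq F] (n : ℕ)
    (hcard : Fintype.card F = n) (hn : 5 < n) (hmod : n % 4 = 1)
    (x y : F) (hxy : x - y ≠ 0 ∧ IsSquare (x - y))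
    (S : Finset F) (hS : S ⊆ Finset.univ \ {x, y})
    (hScard : 3 * (n - 1) ≤ 4 * S.card) :
    ∃ w ∈ S, ∃ z ∈ S,
      (x - w ≠ 0 ∧ IsSquare (x - w)) ∧
      (w - z ≠ 0 ∧ IsSquare (w - z)) ∧
      (z - y ≠ 0 ∧ IsSquare (z - y)) ∧
      ¬ IsSquare (x - z) ∧ ¬ IsSquare (y - w) := by
  obtain ⟨t, ht⟩ : ∃ t, n = 4 * t + 1 := ⟨n / 4, by omega⟩
  have hc : Fintype.card F = 4 * t + 1 := hcard.trans ht
  obtain ⟨hd, hsq⟩ := hxy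
  have hchi : quadraticChar F (x - y) = 1 := (quadraticChar_one_iff_isSquare hd).2 hsq
  have one : ∀ a : F, quadraticChar F a = 1 → a ≠ 0 ∧ IsSquare a := by
    intro a ha
    have h0 : a ≠ 0 := by rintro rfl; simp at ha
    exact ⟨h0, (quadraticChar_one_iff_isSquare h0).1 ha⟩
  have sc : ∀ a : F, quadraticChar F ((x - y) * a) = quadraticChar F a := by
    intro a; rw [map_mul, hchi, one_mul]
  have inj : Function.Injective (fun v : F => (v - y) / (x - y)) := by
    intro a b h
    have h' : (a - y) / (x - y) = (b - y) / (x - y) := h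
    rw [div_left_inj' hd] at h'
    simpa using h'
  have hSx : x ∉ S := fun h => by simpa using hS h
  have hSy : y ∉ S := fun h => by simpa using hS h
  obtain ⟨w', hw', z', hz', h1, h2, h3, h4, h5⟩ := paley_normalized (by omega : 2 ≤ t) hc
    (S.image (fun v : F => (v - y) / (x - y)))
    (by
      intro h
      obtain ⟨v, hv, e⟩ := Finset.mem_image.1 h
      rw [div_eq_zero_iff, or_iff_left hd, sub_eq_zero] at e
      exact hSy (e ▸ hv))
    (by
      intro h
      obtain ⟨v, hv, e⟩ := Finset.mem_image.1 h
      rw [div_eq_one_iff_eq hd, sub_left_inj] at e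
      exact hSx (e ▸ hv))
    (by rw [Finset.card_image_of_injective _ inj]; omega)
  obtain ⟨w, hw, rfl⟩ := Finset.mem_image.1 hw'
  obtain ⟨z, hz, rfl⟩ := Finset.mem_image.1 hz'
  rw [← sc] at h1 h2 h3 h4 h5
  refine ⟨w, hw, z, hz, one _ ?_, one _ ?_, one _ ?_,
    quadraticChar_neg_one_iff_not_isSquare.1 ?_, quadraticChar_neg_one_iff_not_isSquare.1 ?_⟩
  · rw [← h1]; congr 1; field_simp; ring
  · rw [← h2]; congr 1; field_simp; ring
  · rw [← h3]; congr 1; field_simp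
  · rw [← h4]; congr 1; field_simp; ring
  · rw [paley_chi_sub_comm hc, ← h5]; congr 1; field_simp
end

section
/- Let G be an amply regular graph with parameters (n, d, α, β) with β = α + 1, n < 3d − 2α, and d > α + √(6α + 1/4) + 3/2. Then for every edge xy of G there is a perfect matching between N_x = Γ(x) \ (Γ(x)∩Γ(y) ∪ {y}) and N_y = Γ(y) \ (Γ(x)∩Γ(y) ∪ {x}). -/
set_option linter.unusedSectionVars false

namespace AmplyMatching

open Finset

variable {V : Type*} [Fintype V] [DecidableEq V]

/-- Adjacency indicator. -/
def ai (G : SimpleGraph V) [DecidableRel G.Adj] (v w : V) : ℤ := if G.Adj v w then 1 else 0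

/-- Common neighbours. -/
def cD (G : SimpleGraph V) [DecidableRel G.Adj] (x y : V) : Finset V :=
  univ.filter fun z => G.Adj x z ∧ G.Adj y z

/-- Private neighbours of the first vertex. -/
def cX (G : SimpleGraph V) [DecidableRel G.Adj] (x y : V) : Finset V :=
  univ.filter fun z => G.Adj x z ∧ ¬ G.Adj y z ∧ z ≠ y

/-- The remaining vertices. -/
def cR (G : SimpleGraph V) [DecidableRel G.Adj] (x y : V) : Finset V :=
  univ.filter fun z => ¬ G.Adj x z ∧ ¬ G.Adj y z

section
variable (G : SimpleGraph V) [DecidableRel G.Adj]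

theorem ai_nonneg (v w : V) : 0 ≤ ai G v w := by unfold ai; split_ifs <;> simp

theorem ai_le_one (v w : V) : ai G v w ≤ 1 := by unfold ai; split_ifs <;> simp

theorem ai_sq (v w : V) : ai G v w * ai G v w = ai G v w := by unfold ai; split_ifs <;> simp

theorem ai_symm (v w : V) : ai G v w = ai G w v := by unfold ai; simp [G.adj_comm]

theorem ai_one {v w : V} (h : G.Adj v w) : ai G v w = 1 := by simp [ai, h]

theorem ai_zero {v w : V} (h : ¬ G.Adj v w) : ai G v w = 0 := by simp [ai, h]

theorem sum_x {x y : V} (hxy : G.Adj x y) (f : V → ℤ) :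
    ∑ w, ai G x w * f w = f y + ∑ w ∈ cD G x y, f w + ∑ w ∈ cX G x y, f w := by
  have h1 : f y = ∑ w, if w = y then f w else 0 := by simp
  rw [h1, cD, cX, sum_filter, sum_filter, ← sum_add_distrib, ← sum_add_distrib]
  apply sum_congr rfl
  intro w _
  unfold ai
  by_cases hw : w = y
  · subst hw; simp [hxy]
  · by_cases h1 : G.Adj x w <;> by_cases h2 : G.Adj y w <;> simp [h1, h2, hw]

theorem sum_y {x y : V} (hxy : G.Adj x y) (f : V → ℤ) :
    ∑ w, ai G y w * f w = f x + ∑ w ∈ cD G x y, f w + ∑ w ∈ cX G y x, f w := by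
  have h := sum_x G hxy.symm f
  have h2 : cD G y x = cD G x y := by ext; simp [cD, and_comm]
  rwa [h2] at h

theorem sum_all {x y : V} (hxy : G.Adj x y) (f : V → ℤ) :
    ∑ w, f w = f x + f y + ∑ w ∈ cD G x y, f w + ∑ w ∈ cX G x y, f w
      + ∑ w ∈ cX G y x, f w + ∑ w ∈ cR G x y, f w := by
  have h1 : f y = ∑ w, if w = y then f w else 0 := by simp
  have h2 : f x = ∑ w, if w = x then f w else 0 := by simp
  rw [h1, h2, cD, cX, cX, cR, sum_filter, sum_filter, sum_filter, sum_filter]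
  simp only [← sum_add_distrib]
  apply sum_congr rfl
  intro w _
  by_cases hw : w = y
  · subst hw; simp [hxy, hxy.ne']
  · by_cases hw' : w = x
    · subst hw'; simp [hxy.symm, hxy.ne]
    · by_cases h1 : G.Adj x w <;> by_cases h2 : G.Adj y w <;> simp [h1, h2, hw, hw']

/-- The counting hypotheses in indicator form. -/
structure Good (d α m : ℕ) : Prop where
  hd : d = m + α + 1
  reg : ∀ v, ∑ w, ai G v w = d
  adj : ∀ u v, G.Adj u v → ∑ w, ai G u w * ai G v w = α
  two : ∀ u v z, u ≠ v → ¬ G.Adj u v → G.Adj u z → G.Adj v z →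
    ∑ w, ai G u w * ai G v w = α + 1
  card : Fintype.card V ≤ 3 * m + α + 2
  big : 6 * α < m * (m - 1)
  hm : 2 ≤ m

variable {G} {d α m : ℕ}

theorem card_D (g : Good G d α m) {x y : V} (hxy : G.Adj x y) : (((cD G x y).card : ℕ) : ℤ) = α := by
  have h := g.adj x y hxy
  rw [sum_x G hxy, ai_zero G (G.irrefl)] at h
  rw [← h]
  have h1 : ∑ w ∈ cD G x y, ai G y w = ∑ w ∈ cD G x y, 1 :=
    sum_congr rfl fun w hw => ai_one G (by simp [cD] at hw; exact hw.2)
  have h2 : ∑ w ∈ cX G x y, ai G y w = 0 :=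
    sum_eq_zero fun w hw => ai_zero G (by simp [cX] at hw; exact hw.2.1)
  rw [h1, h2]; simp

theorem card_X (g : Good G d α m) {x y : V} (hxy : G.Adj x y) : (((cX G x y).card : ℕ) : ℤ) = m := by
  have h := g.reg x
  have h1 := sum_x G hxy (fun _ => 1)
  have h2 := card_D g hxy
  have h3 := g.hd
  simp at h1
  push_cast [h3] at h
  linarith

theorem card_R (g : Good G d α m) {x y : V} (hxy : G.Adj x y) : (((cR G x y).card : ℕ) : ℤ) ≤ m := by
  have h1 := sum_all G hxy (fun _ => 1)
  have h2 := card_D g hxy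
  have h3 := card_X g hxy
  have h4 := card_X g hxy.symm
  have h5 := g.card
  simp at h1
  zify at h5
  linarith

theorem u_facts (g : Good G d α m) {x y u : V} (hxy : G.Adj x y) (hu : u ∈ cX G x y) :
    ∑ w ∈ cX G x y, ai G u w = ∑ w ∈ cX G y x, ai G u w ∧
    ∑ w ∈ cD G x y, ai G u w = α - ∑ w ∈ cX G y x, ai G u w ∧
    ∑ w ∈ cR G x y, ai G u w = m - ∑ w ∈ cX G y x, ai G u w := by
  simp only [cX, mem_filter, mem_univ, true_and] at hu
  obtain ⟨h1, h2, h3⟩ := hu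
  have e1 := g.adj x u h1
  have e2 := g.two y u x h3.symm h2 hxy.symm h1.symm
  have e3 := g.reg u
  have h4 := g.hd
  rw [sum_x G hxy] at e1
  rw [sum_y G hxy] at e2
  rw [sum_all G hxy] at e3
  have a1 : ai G u x = 1 := ai_one G h1.symm
  have a2 : ai G u y = 0 := ai_zero G fun h => h2 h.symm
  push_cast [h4] at e3
  rw [a1] at e2 e3
  rw [a2] at e1 e3
  refine ⟨?_, ?_, ?_⟩ <;> linarith

theorem full_of_sum {A : Finset V} {f : V → ℤ} (hf : ∀ w, f w ≤ 1)
    (h : (A.card : ℤ) ≤ ∑ w ∈ A, f w) : ∀ w ∈ A, f w = 1 := by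
  intro w hw
  by_contra hne
  have h1 : f w < 1 := lt_of_le_of_ne (hf w) hne
  have : ∑ w ∈ A, f w < ∑ w ∈ A, 1 := sum_lt_sum (fun i _ => hf i) ⟨w, hw, h1⟩
  simp at this
  linarith

theorem adj_of_ai {v w : V} (h : ai G v w = 1) : G.Adj v w := by
  by_contra hn
  rw [ai_zero G hn] at h
  omega

theorem single (g : Good G d α m) {x y u : V} (hxy : G.Adj x y) (hu : u ∈ cX G x y)
    (h0 : ∀ w ∈ cX G y x, ¬ G.Adj u w) : False := by
  have hm := g.hm
  have key : ∀ u ∈ cX G x y, ∑ w ∈ cX G y x, ai G u w = 0 →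
      (∀ w ∈ cX G y x, ai G u w = 0) ∧ (∀ w ∈ cX G x y, ai G u w = 0) ∧
      (∀ w ∈ cD G x y, ai G u w = 1) ∧ (∀ w ∈ cR G x y, ai G u w = 1) ∧
      ((cR G x y).card : ℤ) = m := by
    intro u hu hz
    obtain ⟨f1, f2, f3⟩ := u_facts g hxy hu
    rw [hz] at f1 f2 f3
    have hR := card_R g hxy
    have hD := card_D g hxy
    have hRR : ((cR G x y).card : ℤ) ≤ ∑ w ∈ cR G x y, ai G u w := by linarith
    refine ⟨?_, ?_, ?_, ?_, ?_⟩
    · exact (sum_eq_zero_iff_of_nonneg (fun i _ => ai_nonneg G u i)).1 hz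
    · exact (sum_eq_zero_iff_of_nonneg (fun i _ => ai_nonneg G u i)).1 f1
    · exact full_of_sum (ai_le_one G u) (by linarith)
    · exact full_of_sum (ai_le_one G u) hRR
    · have : ∑ w ∈ cR G x y, ai G u w ≤ ∑ w ∈ cR G x y, 1 :=
        sum_le_sum fun i _ => ai_le_one G u i
      simp at this
      linarith
  have hz : ∑ w ∈ cX G y x, ai G u w = 0 := sum_eq_zero fun w hw => ai_zero G (h0 w hw)
  obtain ⟨kY, kX, kD, kR, kc⟩ := key u hu hz
  have hu' := hu
  simp only [cX, mem_filter, mem_univ, true_and] at hu'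
  obtain ⟨hxu, hyu, huy⟩ := hu'
  have common : ∀ f : V → ℤ, ∑ w, ai G u w * f w
      = f x + ∑ w ∈ cD G x y, f w + ∑ w ∈ cR G x y, f w := by
    intro f
    rw [sum_all G hxy, ai_one G hxu.symm, ai_zero G (fun h => hyu h.symm),
      sum_congr rfl (fun w hw => by rw [kD w hw]),
      sum_congr (s₁ := cX G x y) rfl (fun w hw => by rw [kX w hw]),
      sum_congr (s₁ := cX G y x) rfl (fun w hw => by rw [kY w hw]),
      sum_congr (s₁ := cR G x y) rfl (fun w hw => by rw [kR w hw])]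
    simp
  rcases Nat.eq_zero_or_pos α with ha | ha
  · have hX := card_X g hxy
    have : 1 < (cX G x y).card := by omega
    obtain ⟨v, hv, hvu⟩ := exists_mem_ne this u
    have hv' := hv
    simp only [cX, mem_filter, mem_univ, true_and] at hv'
    obtain ⟨f1, f2, f3⟩ := u_facts g hxy hv
    have n1 : 0 ≤ ∑ w ∈ cD G x y, ai G v w := sum_nonneg fun i _ => ai_nonneg G v i
    have n2 : 0 ≤ ∑ w ∈ cX G y x, ai G v w := sum_nonneg fun i _ => ai_nonneg G v i
    have hz' : ∑ w ∈ cX G y x, ai G v w = 0 := by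
      rw [ha] at f2; push_cast at f2; linarith
    have hna : ¬ G.Adj u v := fun h => by
      have := kX v hv
      rw [ai_one G h] at this
      omega
    have e := g.two u v x hvu.symm hna hxu.symm hv'.1.symm
    rw [common, f3, f2, hz', ai_one G hv'.1.symm] at e
    omega
  · have hD := card_D g hxy
    have : 0 < (cD G x y).card := by omega
    obtain ⟨z, hzD⟩ := card_pos.1 this
    have hz' := hzD
    simp only [cD, mem_filter, mem_univ, true_and] at hz'
    obtain ⟨hxz, hyz⟩ := hz'
    have huz : G.Adj u z := adj_of_ai (kD z hzD)
    have hdd := g.hd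
    have e1 := g.adj x z hxz
    have e2 := g.adj y z hyz
    have e3 := g.adj u z huz
    have e4 := g.reg z
    rw [sum_x G hxy, ai_one G hyz.symm] at e1
    rw [sum_y G hxy, ai_one G hxz.symm] at e2
    rw [common, ai_one G hxz.symm] at e3
    rw [sum_all G hxy, ai_one G hyz.symm, ai_one G hxz.symm] at e4
    have hpos : 0 < ∑ w ∈ cR G x y, ai G z w := by omega
    obtain ⟨w, hwR, hw0⟩ := exists_ne_zero_of_sum_ne_zero hpos.ne'
    have hzw : G.Adj z w := by
      by_contra hn
      exact hw0 (ai_zero G hn)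
    have huw : G.Adj u w := adj_of_ai (kR w hwR)
    have hw' := hwR
    simp only [cR, mem_filter, mem_univ, true_and] at hw'
    obtain ⟨hxw, hyw⟩ := hw'
    have hwx : x ≠ w := by rintro rfl; exact hyw hxy.symm
    have hwy : y ≠ w := by rintro rfl; exact hxw hxy
    have c1 := g.two x w z hwx hxw hxz hzw.symm
    have c2 := g.two y w z hwy hyw hyz hzw.symm
    have c3 := g.adj u w huw
    have c4 := g.reg w
    have b1 : ai G w x = 0 := ai_zero G fun h => hxw h.symm
    have b2 : ai G w y = 0 := ai_zero G fun h => hyw h.symm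
    rw [sum_x G hxy, b2] at c1
    rw [sum_y G hxy, b1] at c2
    rw [common, b1] at c3
    rw [sum_all G hxy, b1, b2] at c4
    omega

theorem arith (m a j e QX QY QD QR : ℝ) (hm : 4 ≤ m) (ha : 0 < a) (hj : 1 ≤ j)
    (h6 : 6 * a < m * (m - 1)) (h2 : 2 * j ≤ m - 1)
    (hX : e ^ 2 ≤ m * QX) (hY : e ^ 2 ≤ j * QY) (hD : (a * (j + 1) - e) ^ 2 ≤ a * QD)
    (hR : (m * (j + 1) - e) ^ 2 ≤ m * QR)
    (h : (j + 1) ^ 2 + QX + QY + QD + QR ≤ (j + 1) * m + (a + 1) * (j + 1) ^ 2) : False := by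
  have m0 : 0 < m := by linarith
  have j0 : 0 < j := by linarith
  have X' : e ^ 2 / m ≤ QX := by rw [div_le_iff₀ m0]; linarith
  have Y' : e ^ 2 / j ≤ QY := by rw [div_le_iff₀ j0]; linarith
  have D' : (a * (j + 1) - e) ^ 2 / a ≤ QD := by rw [div_le_iff₀ ha]; linarith
  have R' : (m * (j + 1) - e) ^ 2 / m ≤ QR := by rw [div_le_iff₀ m0]; linarith
  set c := 2 / m + 1 / j + 1 / a with hc
  have c0 : 0 < c := by positivity
  have hsum : e ^ 2 / m + e ^ 2 / j + (a * (j + 1) - e) ^ 2 / a + (m * (j + 1) - e) ^ 2 / m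
      = c * e ^ 2 - 4 * e * (j + 1) + (a + m) * (j + 1) ^ 2 := by
    rw [hc]; field_simp; ring
  have main : c * e ^ 2 - 4 * e * (j + 1) + m * (j + 1) ^ 2 - (j + 1) * m ≤ 0 := by nlinarith
  have hcm : 4 * (j + 1) < c * m * j := by
    have e1 : c * m * j = 2 * j + m + m * j / a := by rw [hc]; field_simp
    rw [e1]
    have e2 : (2 * j + 4 - m) < m * j / a := by
      rw [lt_div_iff₀ ha]
      rcases le_or_gt (2 * j + 4 - m) 0 with hn | hp
      · have := mul_pos m0 j0
        nlinarith
      · have t1 : 6 * ((2 * j + 4 - m) * a) < (2 * j + 4 - m) * (m * (m - 1)) := by nlinarith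
        have t2 : 0 ≤ m * ((m - 4) * (m - 1 - 2 * j)) :=
          mul_nonneg m0.le (mul_nonneg (by linarith) (by linarith))
        nlinarith
    linarith
  have id1 : c * (c * e ^ 2 - 4 * e * (j + 1) + m * (j + 1) ^ 2 - (j + 1) * m)
      = (c * e - 2 * (j + 1)) ^ 2 + (j + 1) * (c * m * j - 4 * (j + 1)) := by ring
  have p1 : 0 < (j + 1) * (c * m * j - 4 * (j + 1)) := mul_pos (by linarith) (by linarith)
  nlinarith [sq_nonneg (c * e - 2 * (j + 1))]

theorem core (g : Good G d α m) {x y : V} (hxy : G.Adj x y) (S T : Finset V) (hS : S ⊆ cX G x y)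
    (hT : T ⊆ cX G y x) (hST : ∀ u ∈ S, ∀ w ∈ cX G y x, G.Adj u w → w ∈ T)
    (hlt : T.card < S.card) (hsmall : 2 * S.card ≤ m + 1) : False := by
  by_cases hne : ∃ u ∈ S, ∀ w ∈ cX G y x, ¬ G.Adj u w
  · obtain ⟨u, hu, h⟩ := hne
    exact single g hxy (hS hu) h
  push Not at hne
  obtain ⟨u0, hu0⟩ : S.Nonempty := card_pos.1 (by omega)
  obtain ⟨w0, hw0, hadj0⟩ := hne u0 hu0
  have hTpos : 0 < T.card := card_pos.2 ⟨w0, hST u0 hu0 w0 hw0 hadj0⟩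
  have hα : 0 < α := by
    by_contra hα
    have hα : α = 0 := by omega
    obtain ⟨f1, f2, f3⟩ := u_facts g hxy (hS hu0)
    have n1 : 0 ≤ ∑ w ∈ cD G x y, ai G u0 w := sum_nonneg fun i _ => ai_nonneg G u0 i
    have n2 : ai G u0 w0 ≤ ∑ w ∈ cX G y x, ai G u0 w :=
      single_le_sum (f := fun w => ai G u0 w) (fun i _ => ai_nonneg G u0 i) hw0
    rw [ai_one G hadj0] at n2
    omega
  set f : V → ℤ := fun w => ∑ u ∈ S, ai G u w with hf
  set e : ℤ := ∑ w ∈ cX G y x, f w with he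
  have swap : ∀ A : Finset V, ∑ w ∈ A, f w = ∑ u ∈ S, ∑ w ∈ A, ai G u w := fun A => sum_comm
  have fX : ∑ w ∈ cX G x y, f w = e := by
    rw [he, swap, swap]
    exact sum_congr rfl fun u hu => (u_facts g hxy (hS hu)).1
  have fD : ∑ w ∈ cD G x y, f w = α * S.card - e := by
    rw [he, swap, swap, sum_congr rfl fun u hu => (u_facts g hxy (hS hu)).2.1,
      sum_sub_distrib]
    simp [mul_comm]
  have fR : ∑ w ∈ cR G x y, f w = m * S.card - e := by
    rw [he, swap, swap, sum_congr rfl fun u hu => (u_facts g hxy (hS hu)).2.2,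
      sum_sub_distrib]
    simp [mul_comm]
  have hS' : ∀ u ∈ S, G.Adj x u ∧ ¬ G.Adj y u ∧ u ≠ y := fun u hu => by
    have := hS hu
    simpa [cX] using this
  have fx : f x = S.card := by
    rw [hf]
    simp only
    rw [sum_congr rfl fun u hu => ai_one G (hS' u hu).1.symm]
    simp
  have fT : ∀ w ∈ cX G y x, w ∉ T → f w = 0 := fun w hw hwT =>
    sum_eq_zero fun u hu => ai_zero G fun h => hwT (hST u hu w hw h)
  have eT : ∑ w ∈ T, f w = e := sum_subset hT fT
  have qT : ∑ w ∈ T, f w ^ 2 = ∑ w ∈ cX G y x, f w ^ 2 :=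
    sum_subset hT fun w hw hwT => by rw [fT w hw hwT]; rfl
  have tot : ∑ w, f w ^ 2 ≤ S.card * m + (α + 1) * (S.card : ℤ) ^ 2 := by
    have h1 : ∑ w, f w ^ 2 = ∑ u ∈ S, ∑ v ∈ S, ∑ w, ai G u w * ai G v w := by
      simp only [hf, sq, sum_mul_sum]
      rw [sum_comm]
      exact sum_congr rfl fun u _ => sum_comm
    have h2 : ∀ u ∈ S, ∀ v ∈ S, ∑ w, ai G u w * ai G v w
        ≤ (if u = v then (m : ℤ) else 0) + (α + 1) := by
      intro u hu v hv
      by_cases huv : u = v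
      · subst huv
        simp only [ai_sq, g.reg, g.hd]
        push_cast
        simp
      · by_cases hA : G.Adj u v
        · rw [g.adj u v hA]; simp [huv]
        · rw [g.two u v x huv hA (hS' u hu).1.symm (hS' v hv).1.symm]; simp [huv]
    rw [h1]
    refine (sum_le_sum fun u hu => sum_le_sum fun v hv => h2 u hu v hv).trans (le_of_eq ?_)
    simp [sum_add_distrib]
    ring
  rw [sum_all G hxy, fx] at tot
  have CX := sq_sum_le_card_mul_sum_sq (s := cX G x y) (f := f)
  have CD := sq_sum_le_card_mul_sum_sq (s := cD G x y) (f := f)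
  have CR := sq_sum_le_card_mul_sum_sq (s := cR G x y) (f := f)
  have CT := sq_sum_le_card_mul_sum_sq (s := T) (f := f)
  rw [fX, card_X g hxy] at CX
  rw [fD, card_D g hxy] at CD
  rw [fR] at CR
  rw [eT, qT] at CT
  have nn : ∀ A : Finset V, 0 ≤ ∑ w ∈ A, f w ^ 2 := fun A => sum_nonneg fun i _ => sq_nonneg _
  have CR' := CR.trans (mul_le_mul_of_nonneg_right (card_R g hxy) (nn (cR G x y)))
  obtain ⟨j, hj⟩ : ∃ j, S.card = j + 1 := ⟨S.card - 1, by omega⟩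
  have hTj : (T.card : ℤ) ≤ j := by omega
  have CT' := CT.trans (mul_le_mul_of_nonneg_right hTj (nn (cX G y x)))
  rw [hj] at CD CR' tot
  have hb := g.big
  have hm2 := g.hm
  have hm4 : 4 ≤ m := by
    by_contra hlt4
    have : m = 2 ∨ m = 3 := by omega
    rcases this with h | h <;> subst h <;> omega
  have hb' : 6 * (α : ℤ) < m * (m - 1) := by
    zify [show 1 ≤ m by omega] at hb
    exact hb
  have y0 := sq_nonneg (f y)
  refine arith (m : ℝ) α j e ((∑ w ∈ cX G x y, f w ^ 2 : ℤ) : ℝ)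
    ((∑ w ∈ cX G y x, f w ^ 2 : ℤ) : ℝ) ((∑ w ∈ cD G x y, f w ^ 2 : ℤ) : ℝ)
    ((∑ w ∈ cR G x y, f w ^ 2 : ℤ) : ℝ) (by exact_mod_cast hm4) (by exact_mod_cast hα)
    ?_ (by exact_mod_cast hb') ?_ (by exact_mod_cast CX) (by exact_mod_cast CT')
    (by exact_mod_cast CD) (by exact_mod_cast CR') ?_
  · have : 1 ≤ j := by omega
    exact_mod_cast this
  · have : (2 * j : ℤ) ≤ m - 1 := by omega
    exact_mod_cast this
  · push_cast at tot
    have : ((j : ℤ) + 1) ^ 2 + ∑ w ∈ cX G x y, f w ^ 2 + ∑ w ∈ cX G y x, f w ^ 2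
      + ∑ w ∈ cD G x y, f w ^ 2 + ∑ w ∈ cR G x y, f w ^ 2
      ≤ (j + 1) * m + (α + 1) * ((j : ℤ) + 1) ^ 2 := by linarith
    exact_mod_cast this

theorem hall (g : Good G d α m) {x y : V} (hxy : G.Adj x y) (S : Finset V) (hS : S ⊆ cX G x y) :
    S.card ≤ ((cX G y x).filter fun w => ∃ u ∈ S, G.Adj u w).card := by
  by_contra hlt
  set T := (cX G y x).filter fun w => ∃ u ∈ S, G.Adj u w with hTdef
  have hT : T ⊆ cX G y x := filter_subset _ _
  have hST : ∀ u ∈ S, ∀ w ∈ cX G y x, G.Adj u w → w ∈ T := fun u hu w hw h =>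
    mem_filter.2 ⟨hw, u, hu, h⟩
  by_cases hs : 2 * S.card ≤ m + 1
  · exact core g hxy S T hS hT hST (by omega) hs
  · have cx := card_X g hxy
    have cy := card_X g hxy.symm
    have k1 := card_sdiff_of_subset hS
    have k2 := card_sdiff_of_subset hT
    have k3 := card_le_card hS
    obtain ⟨S2, hS2, hc⟩ := exists_subset_card_eq
      (show m - S.card + 1 ≤ (cX G y x \ T).card by omega)
    refine core g hxy.symm S2 (cX G x y \ S) (hS2.trans sdiff_subset) sdiff_subset ?_
      (by omega) (by omega)
    intro u hu w hw h
    refine mem_sdiff.2 ⟨hw, fun hwS => ?_⟩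
    have hu2 := mem_sdiff.1 (hS2 hu)
    exact hu2.2 (hST w hwS u hu2.1 h.symm)

theorem matching (g : Good G d α m) {x y : V} (hxy : G.Adj x y) :
    ∃ φ : {z : V // G.Adj x z ∧ ¬ G.Adj y z ∧ z ≠ y} ≃
            {z : V // G.Adj y z ∧ ¬ G.Adj x z ∧ z ≠ x},
        ∀ v, G.Adj v.1 (φ v).1 := by
  let t : {z : V // G.Adj x z ∧ ¬ G.Adj y z ∧ z ≠ y} →
    Finset {z : V // G.Adj y z ∧ ¬ G.Adj x z ∧ z ≠ x} :=
    fun u => univ.filter fun w => G.Adj u.1 w.1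
  have hh : ∀ s : Finset {z : V // G.Adj x z ∧ ¬ G.Adj y z ∧ z ≠ y},
      s.card ≤ (s.biUnion t).card := by
    intro s
    have h := hall g hxy (s.map (Function.Embedding.subtype _)) (by
      intro z hz
      simp only [mem_map, Function.Embedding.coe_subtype] at hz
      obtain ⟨a, _, rfl⟩ := hz
      simpa [cX] using a.2)
    rw [card_map] at h
    refine h.trans ?_
    rw [← card_map (Function.Embedding.subtype _) (s := s.biUnion t)]
    apply card_le_card
    intro w hw
    simp only [mem_filter, cX, mem_univ, true_and, mem_map,
      Function.Embedding.coe_subtype] at hw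
    obtain ⟨hw1, u, ⟨a, ha, rfl⟩, hau⟩ := hw
    simp only [mem_map, mem_biUnion, Function.Embedding.coe_subtype]
    exact ⟨⟨w, hw1⟩, ⟨a, ha, by simpa [t] using hau⟩, rfl⟩
  obtain ⟨φ, hinj, hφ⟩ := (all_card_le_biUnion_card_iff_exists_injective t).1 hh
  have hcard : Fintype.card {z : V // G.Adj x z ∧ ¬ G.Adj y z ∧ z ≠ y} =
      Fintype.card {z : V // G.Adj y z ∧ ¬ G.Adj x z ∧ z ≠ x} := by
    have c1 := card_X g hxy
    have c2 := card_X g hxy.symm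
    rw [Fintype.card_subtype, Fintype.card_subtype]
    unfold cX at c1 c2
    omega
  refine ⟨Equiv.ofBijective φ ((Fintype.bijective_iff_injective_and_card φ).2 ⟨hinj, hcard⟩), ?_⟩
  intro v
  have := hφ v
  simpa [t] using this

end

theorem dist_two {V : Type*} (G : SimpleGraph V) {u v z : V} (huv : u ≠ v) (h : ¬ G.Adj u v)
    (h1 : G.Adj u z) (h2 : G.Adj v z) : G.dist u v = 2 := by
  let p : G.Walk u v := .cons h1 (.cons h2.symm .nil)
  have hle : G.dist u v ≤ 2 := G.dist_le p
  have h0 : G.dist u v ≠ 0 := by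
    have := (SimpleGraph.Reachable.pos_dist_of_ne ⟨p⟩ huv)
    omega
  have h1 : G.dist u v ≠ 1 := fun hh => h (SimpleGraph.dist_eq_one_iff_adj.1 hh)
  omega

theorem common_sum (G : SimpleGraph V) [DecidableRel G.Adj] (u v : V) :
    ∑ w, ai G u w * ai G v w = (Fintype.card (G.commonNeighbors u v) : ℤ) := by
  have : Fintype.card (G.commonNeighbors u v) =
      (univ.filter fun w => G.Adj u w ∧ G.Adj v w).card := by
    rw [← Set.toFinset_card]
    congr 1
    ext w
    simp [SimpleGraph.mem_commonNeighbors]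
  rw [this, card_filter]
  push_cast
  apply sum_congr rfl
  intro w _
  unfold ai
  by_cases h1 : G.Adj u w <;> by_cases h2 : G.Adj v w <;> simp [h1, h2]

end AmplyMatching

theorem amply_regular_case_one_local_perfect_matching
    {V : Type*} [Fintype V] [DecidableEq V] (G : SimpleGraph V) [DecidableRel G.Adj]
    (n d α β : ℕ)
    (hn : Fintype.card V = n)
    (hreg : G.IsRegularOfDegree d)
    (hadj : ∀ v w : V, G.Adj v w → Fintype.card (G.commonNeighbors v w) = α)
    (hdist : ∀ v w : V, G.dist v w = 2 → Fintype.card (G.commonNeighbors v w) = β)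
    (hβ : β = α + 1)
    (hnsmall : (n : ℤ) < 3 * d - 2 * α)
    (hdbig : (α : ℝ) + Real.sqrt (6 * α + 1 / 4) + 3 / 2 < d) :
    ∀ x y : V, G.Adj x y →
      ∃ φ : {z : V // G.Adj x z ∧ ¬ G.Adj y z ∧ z ≠ y} ≃
            {z : V // G.Adj y z ∧ ¬ G.Adj x z ∧ z ≠ x},
        ∀ v, G.Adj v.1 (φ v).1 := by
  intro x y hxy
  have hs0 := Real.sqrt_nonneg (6 * (α : ℝ) + 1 / 4)
  have hα0 : (0 : ℝ) ≤ α := Nat.cast_nonneg α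
  have hs1 := Real.sq_sqrt (show (0 : ℝ) ≤ 6 * α + 1 / 4 by positivity)
  have hd1 : α + 1 < d := by
    have : (α : ℝ) + 1 < d := by linarith
    exact_mod_cast this
  obtain ⟨m, hm⟩ : ∃ m, d = m + α + 1 := ⟨d - α - 1, by omega⟩
  have hmpos : 1 ≤ m := by omega
  have hbigR : 6 * (α : ℝ) < m * (m - 1) := by
    rw [hm] at hdbig
    push_cast at hdbig
    nlinarith
  have hbigZ : 6 * (α : ℤ) < m * (m - 1) := by exact_mod_cast hbigR
  have hbig : 6 * α < m * (m - 1) := by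
    zify [hmpos]
    exact hbigZ
  have hm2 : 2 ≤ m := by
    by_contra h
    have : m = 1 := by omega
    subst this
    omega
  have g : AmplyMatching.Good G d α m := by
    refine ⟨hm, ?_, ?_, ?_, ?_, hbig, hm2⟩
    · intro v
      have h := hreg v
      rw [← h, ← G.card_neighborFinset_eq_degree, G.neighborFinset_eq_filter, Finset.card_filter]
      push_cast
      rfl
    · intro u v h
      rw [AmplyMatching.common_sum, hadj u v h]
    · intro u v z huv h h1 h2
      rw [AmplyMatching.common_sum, hdist u v (AmplyMatching.dist_two G huv h h1 h2), hβ]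
      push_cast
      rfl
    · omega
  exact AmplyMatching.matching g hxy
end
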